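/- arXiv:0809.4580 — 4 statements merged into one kernel-verified Lean document; each statement's English description precedes it below -/
import Mathlib

section
/- Let Ω ⊂ ℝ^n be an open bounded convex set and let u be the torsion function of Ω. Then |∇u(x)| ≤ diam(Ω) for every x ∈ Ω. -/
open MeasureTheory Metric Set Filter Bornology
open scoped Topology Pointwise RealInnerProductSpace ENNReal NNReal BigOperators Classical

noncomputable section

/-- Euclidean `n`-space. -/
abbrev Euc (n : ℕ) : Type := EuclideanSpace ℝ (Fin n)

variable {n : ℕ}

/-- The Laplacian of `u`, as the sum of the pure second derivatives in the coordinate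
directions. -/
def lapl (u : Euc n → ℝ) (x : Euc n) : ℝ :=
  ∑ i : Fin n, iteratedFDeriv ℝ 2 u x (fun _ => EuclideanSpace.single i (1 : ℝ))

/-- `u` is the torsion function of `Ω`: the solution of `Δu = -2` in `Ω`, `u = 0` on `∂Ω`,
continuous up to the boundary and smooth inside. -/
structure IsTorsionFunction (Ω : Set (Euc n)) (u : Euc n → ℝ) : Prop where
  continuousOn : ContinuousOn u (closure Ω)
  smooth : ContDiffOn ℝ (⊤ : ℕ∞) u Ω
  lapl_eq : ∀ x ∈ Ω, lapl u x = -2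
  boundary_zero : ∀ x ∈ frontier Ω, u x = 0

/-- The torsional rigidity `τ(Ω) = ∫_Ω ‖∇u‖²` where `u` is the torsion function of `Ω`. -/
def torsionRigidity (Ω : Set (Euc n)) : ℝ :=
  if h : ∃ u, IsTorsionFunction Ω u then ∫ x in Ω, ‖gradient h.choose x‖ ^ 2 else 0

/-- The nontangential cone `Γ_α(x̄) = {x ∈ Ω : |x - x̄| ≤ (1+α) dist(x, ∂Ω)}`. -/
def ntCone (Ω : Set (Euc n)) (x : Euc n) (α : ℝ) : Set (Euc n) :=
  {y ∈ Ω | dist y x ≤ (1 + α) * infDist y (frontier Ω)}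

/-- `w` has nontangential limit `L` at the boundary point `x`. -/
def HasNTLimitAt {F : Type*} [TopologicalSpace F] (Ω : Set (Euc n)) (w : Euc n → F)
    (x : Euc n) (L : F) : Prop :=
  ∀ α > 0, Tendsto w (𝓝[ntCone Ω x α] x) (𝓝 L)

/-- The nontangential boundary values of `∇u` (junk value `0` where they do not exist). -/
def ntGradient (Ω : Set (Euc n)) (u : Euc n → ℝ) (x : Euc n) : Euc n :=
  if h : ∃ L, HasNTLimitAt Ω (gradient u) x L then h.choose else 0

/-- `X` is an outer unit normal to `K` at `x`. -/
def IsOuterNormalAt (K : Set (Euc n)) (x X : Euc n) : Prop :=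
  ‖X‖ = 1 ∧ ∀ y ∈ K, ⟪y, X⟫ ≤ ⟪x, X⟫

/-- The Gauss map of `K`: the outer unit normal at the points of `∂K` where it is unique
(i.e. where `∂K` is differentiable), junk value `0` elsewhere. -/
def gaussMap (K : Set (Euc n)) (x : Euc n) : Euc n :=
  if h : ∃! X, IsOuterNormalAt K x X then h.choose else 0

/-- The support function of a set: `h_K(X) = sup_{y ∈ K} ⟨y, X⟩`. -/
def suppFn (K : Set (Euc n)) (X : Euc n) : ℝ :=
  sSup ((fun y => ⟪y, X⟫) '' K)

/-- The measure `μ_{τ,Ω}(η) = ∫_{ν⁻¹(η)} |∇u|² dH^{n-1}` (as a set function on Borel sets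
`η ⊆ S^{n-1}`), where `ν` is the Gauss map and `∇u` is taken in the sense of nontangential
limits. -/
def torsionMeasure (Ω : Set (Euc n)) (u : Euc n → ℝ) (η : Set (Euc n)) : ℝ≥0∞ :=
  ∫⁻ x in frontier Ω ∩ gaussMap (closure Ω) ⁻¹' η,
    ENNReal.ofReal (‖ntGradient Ω u x‖ ^ 2) ∂μH[(n : ℝ) - 1]

/-- The mixed torsional rigidity `τ₁(Ω, Ω') = ∫_{∂Ω} h_{Ω'}(ν(x)) ‖∇u(x)‖² dH^{n-1}(x)`. -/
def mixedTorsion (Ω Ω' : Set (Euc n)) : ℝ :=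
  if h : ∃ u, IsTorsionFunction Ω u then
    ∫ x in frontier Ω,
      suppFn (closure Ω') (gaussMap (closure Ω) x) * ‖ntGradient Ω h.choose x‖ ^ 2
        ∂μH[(n : ℝ) - 1]
  else 0

/-- The Alexandrov body `B[g] = {x : ⟨x, X⟩ ≤ g(X) for all X ∈ S^{n-1}}` of a positive
continuous function `g` on the sphere. -/
def alexandrovBody (g : Euc n → ℝ) : Set (Euc n) :=
  {x | ∀ X ∈ sphere (0 : Euc n) 1, ⟪x, X⟫ ≤ g X}

lemma second_deriv_line {f : Euc n → ℝ} {x : Euc n} (hf : ContDiffAt ℝ 2 f x) (v : Euc n) :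
    deriv (deriv fun t : ℝ => f (x + t • v)) 0 = iteratedFDeriv ℝ 2 f x (fun _ => v) := by
  have hline (t : ℝ) : HasDerivAt (fun t : ℝ => x + t • v) v t := by
    simpa using ((hasDerivAt_id t).smul_const v).const_add x
  have htend : Tendsto (fun t : ℝ => x + t • v) (𝓝 0) (𝓝 x) := by
    simpa using (hline 0).continuousAt.tendsto
  have hfirst : (deriv fun t : ℝ => f (x + t • v)) =ᶠ[𝓝 0]
      fun t => fderiv ℝ f (x + t • v) v := by
    filter_upwards [htend.eventually (hf.eventually (by simp))] with t ht
    exact ((ht.differentiableAt (by simp)).hasFDerivAt.comp_hasDerivAt t (hline t)).deriv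
  have hd : HasFDerivAt (fderiv ℝ f) (fderiv ℝ (fderiv ℝ f) x) (x + (0 : ℝ) • v) := by
    have := ((hf.fderiv_right (m := 1) (by norm_num)).differentiableAt (by simp)).hasFDerivAt
    simpa using this
  rw [hfirst.deriv_eq, iteratedFDeriv_two_apply]
  have h := hd.comp_hasDerivAt (0 : ℝ) (hline 0)
  exact (((ContinuousLinearMap.apply ℝ ℝ v).hasFDerivAt.comp_hasDerivAt (0 : ℝ) h)).deriv

lemma lapl_nonpos_of_isLocalMax {f : Euc n → ℝ} {x : Euc n} (hf : ContDiffAt ℝ 2 f x)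
    (hx : IsLocalMax f x) : lapl f x ≤ 0 := by
  refine Finset.sum_nonpos fun i _ => ?_
  rw [← second_deriv_line hf]
  set v : Euc n := EuclideanSpace.single i (1 : ℝ)
  set g : ℝ → ℝ := fun t => f (x + t • v) with hg
  have hline : Continuous fun t : ℝ => x + t • v := by fun_prop
  have htend : Tendsto (fun t : ℝ => x + t • v) (𝓝 0) (𝓝 x) := by
    simpa using hline.tendsto 0
  have hmax : IsLocalMax g 0 := by
    have := htend.eventually hx
    simpa [IsLocalMax, IsMaxFilter, hg] using this
  have hcont : ContinuousAt g 0 := by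
    have h0 : ContinuousAt f (x + (0 : ℝ) • v) := by simpa using hf.continuousAt
    exact ContinuousAt.comp (f := fun t : ℝ => x + t • v) h0 hline.continuousAt
  by_contra! hpos
  have hmin := isLocalMin_of_deriv_deriv_pos hpos hmax.deriv_eq_zero hcont
  have hconst : g =ᶠ[𝓝 0] fun _ => g 0 := by
    filter_upwards [hmax, hmin] with t h1 h2 using le_antisymm h1 h2
  have : deriv (deriv g) 0 = 0 := by
    rw [hconst.deriv.deriv_eq]
    simp
  exact hpos.ne' this

/-- The weak maximum principle for strictly subharmonic functions. -/
lemma le_of_lapl_pos {U : Set (Euc n)} (hUo : IsOpen U) (hUb : IsBounded U) {f : Euc n → ℝ}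
    (hfc : ContinuousOn f (closure U)) (hf : ∀ x ∈ U, ContDiffAt ℝ 2 f x)
    (hpos : ∀ x ∈ U, 0 < lapl f x) {M : ℝ} (hM : ∀ x ∈ frontier U, f x ≤ M) :
    ∀ x ∈ U, f x ≤ M := by
  intro x hx
  obtain ⟨z, hz, hmax⟩ := hUb.isCompact_closure.exists_isMaxOn ⟨x, subset_closure hx⟩ hfc
  have hzU : z ∉ U := fun h =>
    (hpos z h).not_ge (lapl_nonpos_of_isLocalMax (hf z h)
      (hmax.isLocalMax (mem_of_superset (hUo.mem_nhds h) subset_closure)))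
  exact (hmax (subset_closure hx)).trans (hM z (by rw [hUo.frontier_eq]; exact ⟨hz, hzU⟩))

lemma lapl_add {f g : Euc n → ℝ} {x : Euc n} (hf : ContDiffAt ℝ 2 f x)
    (hg : ContDiffAt ℝ 2 g x) : lapl (fun y => f y + g y) x = lapl f x + lapl g x := by
  have h : iteratedFDeriv ℝ 2 (fun y => f y + g y) x
      = iteratedFDeriv ℝ 2 f x + iteratedFDeriv ℝ 2 g x := iteratedFDeriv_add_apply hf hg
  simp [lapl, h, Finset.sum_add_distrib]

lemma lapl_const_mul {f : Euc n → ℝ} {x : Euc n} (c : ℝ) (hf : ContDiffAt ℝ 2 f x) :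
    lapl (fun y => c * f y) x = c * lapl f x := by
  have h : iteratedFDeriv ℝ 2 (c • f) x = c • iteratedFDeriv ℝ 2 f x :=
    iteratedFDeriv_const_smul_apply hf
  change lapl (c • f) x = _
  simp [lapl, h, Finset.mul_sum]

lemma lapl_comp_add_right (f : Euc n → ℝ) (h x : Euc n) :
    lapl (fun y => f (y + h)) x = lapl f (x + h) := by
  simp [lapl, iteratedFDeriv_comp_add_right]

lemma contDiffAt_slab (ν p x : Euc n) (D : ℝ) :
    ContDiffAt ℝ 2 (fun y => ⟪ν, p - y⟫ * (D - ⟪ν, p - y⟫)) x := by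
  have h : ContDiffAt ℝ 2 (fun y => ⟪ν, p - y⟫) x :=
    contDiffAt_const.inner ℝ (contDiffAt_const.sub contDiffAt_id)
  exact h.mul (contDiffAt_const.sub h)

lemma lapl_slab (ν p x : Euc n) (hν : ‖ν‖ = 1) (D : ℝ) :
    lapl (fun y => ⟪ν, p - y⟫ * (D - ⟪ν, p - y⟫)) x = -2 := by
  have hterm (v : Euc n) : iteratedFDeriv ℝ 2
      (fun y => ⟪ν, p - y⟫ * (D - ⟪ν, p - y⟫)) x (fun _ => v) = -2 * ⟪ν, v⟫ ^ 2 := by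
    rw [← second_deriv_line (contDiffAt_slab ν p x D)]
    set a := ⟪ν, p - x⟫ with ha
    set b := ⟪ν, v⟫ with hb
    have hfun : (fun t : ℝ => ⟪ν, p - (x + t • v)⟫ * (D - ⟪ν, p - (x + t • v)⟫))
        = fun t => (a - t * b) * (D - (a - t * b)) := by
      funext t
      rw [← sub_sub, inner_sub_right, inner_smul_right]
    have hlin (t : ℝ) : HasDerivAt (fun t : ℝ => a - t * b) (-b) t := by
      simpa using ((hasDerivAt_id t).mul_const b).const_sub a
    have h1 : deriv (fun t : ℝ => (a - t * b) * (D - (a - t * b)))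
        = fun t => 2 * b * (a - t * b) - b * D := by
      funext t
      have := (hlin t).mul ((hlin t).const_sub D)
      rw [HasDerivAt.deriv (f := fun t : ℝ => (a - t * b) * (D - (a - t * b))) this]
      ring
    rw [hfun, h1, (((hlin 0).const_mul (2 * b)).sub_const (b * D)).deriv]
    ring
  have hsum : ∑ i, ν i ^ 2 = 1 := by
    have := EuclideanSpace.real_norm_sq_eq ν
    rw [hν] at this
    simpa using this.symm
  simp only [lapl, hterm, EuclideanSpace.inner_single_right]
  simp [← Finset.mul_sum, hsum]

namespace IsTorsionFunction

variable {Ω : Set (Euc n)} {u : Euc n → ℝ}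

lemma contDiffAt (hu : IsTorsionFunction Ω u) (hΩo : IsOpen Ω) {x : Euc n} (hx : x ∈ Ω) :
    ContDiffAt ℝ 2 u x :=
  (hu.smooth.contDiffAt (hΩo.mem_nhds hx)).of_le (by
    exact WithTop.coe_le_coe.2 (le_top : (2 : ℕ∞) ≤ ⊤))

lemma eq_zero_of_notMem (hu : IsTorsionFunction Ω u) (hΩo : IsOpen Ω) {x : Euc n}
    (hx : x ∈ closure Ω) (hx' : x ∉ Ω) : u x = 0 :=
  hu.boundary_zero x (by rw [hΩo.frontier_eq]; exact ⟨hx, hx'⟩)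

lemma nonneg (hu : IsTorsionFunction Ω u) (hΩo : IsOpen Ω) (hΩb : IsBounded Ω) :
    ∀ x ∈ closure Ω, 0 ≤ u x := by
  intro x hx
  by_cases hxΩ : x ∈ Ω
  · have := le_of_lapl_pos hΩo hΩb (f := fun y => (-1) * u y) (M := 0)
      (hu.continuousOn.const_mul _ |>.congr fun _ _ => rfl)
      (fun y hy => contDiffAt_const.mul (hu.contDiffAt hΩo hy))
      (fun y hy => by
        rw [lapl_const_mul _ (hu.contDiffAt hΩo hy), hu.lapl_eq y hy]; norm_num)
      (fun y hy => by simp [hu.boundary_zero y hy]) x hxΩ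
    linarith
  · exact (hu.eq_zero_of_notMem hΩo hx hxΩ).ge

/-- Comparison with the torsion function of a slab of width `diam Ω`. -/
lemma le_diam_mul_dist (hu : IsTorsionFunction Ω u) (hΩo : IsOpen Ω) (hΩb : IsBounded Ω)
    (hΩc : Convex ℝ Ω) {x p : Euc n} (hx : x ∈ Ω) (hp : p ∈ closure Ω) (hp' : p ∉ Ω) :
    u x ≤ diam Ω * dist x p := by
  obtain ⟨φ, hφ⟩ := geometric_hahn_banach_open_point hΩc hΩo hp'
  set w : Euc n := (InnerProductSpace.toDual ℝ (Euc n)).symm φ with hw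
  have hwφ (y : Euc n) : ⟪w, y⟫ = φ y := by simp [hw]
  have hw0 : w ≠ 0 := by
    intro h0
    have := hφ x hx
    rw [← hwφ, ← hwφ, h0] at this
    simp at this
  set ν : Euc n := ‖w‖⁻¹ • w with hνw
  have hν : ‖ν‖ = 1 := by
    rw [norm_smul, norm_inv, norm_norm, inv_mul_cancel₀ (norm_ne_zero_iff.2 hw0)]
  set T : Euc n → ℝ := fun y => ⟪ν, p - y⟫ with hT
  have hTc : Continuous T := by fun_prop
  have hT0 : ∀ y ∈ closure Ω, 0 ≤ T y := by
    intro y hy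
    refine closure_minimal (t := {y | 0 ≤ T y}) (fun z hz => ?_)
      (isClosed_le continuous_const hTc) hy
    have := hφ z hz
    change 0 ≤ ⟪ν, p - z⟫
    rw [hνw, real_inner_smul_left, inner_sub_right, hwφ, hwφ]
    exact mul_nonneg (inv_nonneg.2 (norm_nonneg w)) (sub_nonneg.2 this.le)
  have hTle (y : Euc n) : T y ≤ dist y p := by
    have := real_inner_le_norm ν (p - y)
    rwa [hν, one_mul, ← dist_eq_norm, dist_comm] at this
  have hTD : ∀ y ∈ closure Ω, T y ≤ diam Ω := fun y hy => by
    have := dist_le_diam_of_mem hΩb.closure hy hp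
    rw [diam_closure] at this
    exact (hTle y).trans this
  have hb : u x ≤ T x * (diam Ω - T x) := by
    have key (ε : ℝ) (hε : 0 < ε) :
        (1 - ε) * u x + (-1) * (T x * (diam Ω - T x)) ≤ 0 := by
      have hs (y : Euc n) : ContDiffAt ℝ 2 (fun y => T y * (diam Ω - T y)) y :=
        contDiffAt_slab ν p y _
      refine le_of_lapl_pos hΩo hΩb
        (f := fun y => (1 - ε) * u y + (-1) * (T y * (diam Ω - T y))) ?_ ?_ ?_ ?_ x hx
      · exact (continuousOn_const.mul hu.continuousOn).add (by fun_prop)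
      · exact fun y hy => (contDiffAt_const.mul (hu.contDiffAt hΩo hy)).add
          (contDiffAt_const.mul (hs y))
      · intro y hy
        have huy := hu.contDiffAt hΩo hy
        rw [lapl_add (contDiffAt_const.mul huy) (contDiffAt_const.mul (hs y)),
          lapl_const_mul _ huy, lapl_const_mul _ (hs y), hu.lapl_eq y hy, lapl_slab ν p y hν]
        linarith
      · intro y hy
        have hyc := frontier_subset_closure hy
        have := mul_nonneg (hT0 y hyc) (sub_nonneg.2 (hTD y hyc))
        simp only [hu.boundary_zero y hy]
        linarith
    have hlim : Tendsto (fun ε : ℝ => (1 - ε) * u x + (-1) * (T x * (diam Ω - T x))) (𝓝[>] 0)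
        (𝓝 ((1 - 0) * u x + (-1) * (T x * (diam Ω - T x)))) :=
      Continuous.tendsto' (by fun_prop) _ _ rfl |>.mono_left nhdsWithin_le_nhds
    have := le_of_tendsto hlim (eventually_mem_nhdsWithin.mono key)
    linarith
  have h1 := hT0 x (subset_closure hx)
  nlinarith [mul_le_mul_of_nonneg_left (hTle x) (diam_nonneg (s := Ω))]

lemma sub_le_diam_mul_norm (hu : IsTorsionFunction Ω u) (hΩo : IsOpen Ω) (hΩb : IsBounded Ω)
    (hΩc : Convex ℝ Ω) {x h : Euc n} (hx : x ∈ Ω) (hxh : x + h ∈ Ω) :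
    u (x + h) - u x ≤ diam Ω * ‖h‖ := by
  have hpre : Continuous fun y : Euc n => y + h := by fun_prop
  set U : Set (Euc n) := Ω ∩ (fun y => y + h) ⁻¹' Ω with hU
  have hUo : IsOpen U := hΩo.inter (hΩo.preimage hpre)
  have hUb : IsBounded U := hΩb.subset inter_subset_left
  have hcl : ∀ y ∈ closure U, y ∈ closure Ω ∧ y + h ∈ closure Ω := fun y hy =>
    ⟨closure_mono inter_subset_left hy,
      hpre.closure_preimage_subset _ (closure_mono inter_subset_right hy)⟩
  have hMnn : 0 ≤ diam Ω * ‖h‖ := mul_nonneg diam_nonneg (norm_nonneg h)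
  have key (ε : ℝ) (hε : ε ∈ Ioo (0 : ℝ) 1) :
      (1 - ε) * u (x + h) + (-1) * u x ≤ diam Ω * ‖h‖ := by
    have hs : ∀ y ∈ U, ContDiffAt ℝ 2 (fun y => u (y + h)) y := fun y hy =>
      ContDiffAt.comp (f := fun y : Euc n => y + h) y (hu.contDiffAt hΩo hy.2) (by fun_prop)
    refine le_of_lapl_pos hUo hUb (f := fun y => (1 - ε) * u (y + h) + (-1) * u y)
      ?_ ?_ ?_ ?_ x ⟨hx, hxh⟩
    · exact (continuousOn_const.mul (hu.continuousOn.comp hpre.continuousOn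
        fun y hy => (hcl y hy).2)).add
        (continuousOn_const.mul (hu.continuousOn.mono fun y hy => (hcl y hy).1))
    · exact fun y hy => (contDiffAt_const.mul (hs y hy)).add
        (contDiffAt_const.mul (hu.contDiffAt hΩo hy.1))
    · intro y hy
      have huy := hu.contDiffAt hΩo hy.1
      rw [lapl_add (contDiffAt_const.mul (hs y hy)) (contDiffAt_const.mul huy),
        lapl_const_mul _ (hs y hy), lapl_const_mul _ huy, lapl_comp_add_right,
        hu.lapl_eq y hy.1, hu.lapl_eq _ hy.2]
      linarith [hε.1]
    · intro y hy
      rw [hUo.frontier_eq] at hy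
      obtain ⟨hy1, hy2⟩ := hcl y hy.1
      have hy0 := hu.nonneg hΩo hΩb y hy1
      by_cases hyh : y + h ∈ Ω
      · have hyΩ : y ∉ Ω := fun hyΩ => hy.2 ⟨hyΩ, hyh⟩
        have hle := hu.le_diam_mul_dist hΩo hΩb hΩc hyh hy1 hyΩ
        rw [dist_eq_norm, add_sub_cancel_left] at hle
        have := mul_nonneg hε.1.le (hu.nonneg hΩo hΩb _ hy2)
        nlinarith
      · simp only [hu.eq_zero_of_notMem hΩo hy2 hyh]
        linarith
  have hlim : Tendsto (fun ε : ℝ => (1 - ε) * u (x + h) + (-1) * u x) (𝓝[>] 0)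
      (𝓝 ((1 - 0) * u (x + h) + (-1) * u x)) :=
    Continuous.tendsto' (by fun_prop) _ _ rfl |>.mono_left nhdsWithin_le_nhds
  have := le_of_tendsto hlim ((Ioo_mem_nhdsGT one_pos : Ioo (0 : ℝ) 1 ∈ 𝓝[>] 0) |>
    mem_of_superset <| fun ε hε => key ε hε)
  linarith

end IsTorsionFunction

/-- The gradient of the torsion function of an open bounded convex set `Ω` is bounded
by the diameter of `Ω`. -/
theorem norm_gradient_torsion_le_diam (Ω : Set (Euc n))
    (hΩo : IsOpen Ω) (hΩb : IsBounded Ω) (hΩc : Convex ℝ Ω)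
    (u : Euc n → ℝ) (hu : IsTorsionFunction Ω u) :
    ∀ x ∈ Ω, ‖gradient u x‖ ≤ diam Ω := by
  intro x hx
  have hnorm : ‖gradient u x‖ = ‖fderiv ℝ u x‖ := by simp [gradient]
  rw [hnorm]
  have hd := ((hu.contDiffAt hΩo hx).differentiableAt (by simp)).hasFDerivAt
  refine hd.le_of_lip' diam_nonneg ?_
  filter_upwards [hΩo.mem_nhds hx] with y hy
  have h1 := hu.sub_le_diam_mul_norm hΩo hΩb hΩc (x := x) (h := y - x) hx (by simpa using hy)
  have h2 := hu.sub_le_diam_mul_norm hΩo hΩb hΩc (x := y) (h := x - y) hy (by simpa using hx)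
  rw [add_sub_cancel] at h1 h2
  rw [norm_sub_rev x y] at h2
  rw [Real.norm_eq_abs, abs_le]
  constructor <;> linarith

end
end

section
/- Let Ω ⊂ ℝ^n be an open bounded convex set and let u be the torsion function of Ω. Then for H^{n−1}-a.e. x ∈ ∂Ω, the gradient ∇u has a finite nontangential limit at x (i.e., each component of ∇u has a finite nontangential limit at x). -/
open MeasureTheory Metric Set Filter Bornology
open scoped Topology Pointwise RealInnerProductSpace ENNReal NNReal BigOperators Classical

noncomputable section

variable {n : ℕ}

section Laplacian

open Laplacian Module

variable {E : Type*} [NormedAddCommGroup E] [InnerProductSpace ℝ E]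

theorem hasDerivAt_line (y v : E) (t : ℝ) : HasDerivAt (fun t : ℝ => y + t • v) v t := by
  simpa using ((hasDerivAt_id t).smul_const v).const_add y

theorem eventually_hasDerivAt_comp_line {f : E → ℝ} {y : E} (v : E) (hf : ContDiffAt ℝ 2 f y) :
    ∀ᶠ t : ℝ in 𝓝 0, HasDerivAt (fun t : ℝ => f (y + t • v)) (fderiv ℝ f (y + t • v) v) t := by
  have h1 : ∀ᶠ z in 𝓝 y, DifferentiableAt ℝ f z := by
    filter_upwards [hf.eventually (by simp)] with z hz using hz.differentiableAt (by simp)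
  have h2 : Tendsto (fun t : ℝ => y + t • v) (𝓝 0) (𝓝 y) := by
    simpa using (hasDerivAt_line y v 0).continuousAt.tendsto
  filter_upwards [h2.eventually h1] with t ht
  exact ht.hasFDerivAt.comp_hasDerivAt t (hasDerivAt_line y v t)

theorem hasDerivAt_fderiv_comp_line {f : E → ℝ} {y : E} (v : E) (hf : ContDiffAt ℝ 2 f y) :
    HasDerivAt (fun t : ℝ => fderiv ℝ f (y + t • v) v) (iteratedFDeriv ℝ 2 f y ![v, v]) 0 := by
  have h1 : DifferentiableAt ℝ (fderiv ℝ f) (y + (0 : ℝ) • v) := by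
    simpa using (hf.fderiv_right (m := 1) (by norm_num)).differentiableAt (by simp)
  have h2 := h1.hasFDerivAt.comp_hasDerivAt (0 : ℝ) (hasDerivAt_line y v 0)
  have h3 := h2.clm_apply (hasDerivAt_const (0 : ℝ) v)
  simpa [iteratedFDeriv_two_apply] using h3

theorem iteratedFDeriv_two_eq_of_line {f : E → ℝ} {y v : E} (hf : ContDiffAt ℝ 2 f y)
    {g : ℝ → ℝ} {k : ℝ} (hg : ∀ᶠ t in 𝓝 0, HasDerivAt (fun t : ℝ => f (y + t • v)) (g t) t)
    (hk : HasDerivAt g k 0) : iteratedFDeriv ℝ 2 f y ![v, v] = k := by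
  refine (hasDerivAt_fderiv_comp_line v hf).unique (hk.congr_of_eventuallyEq ?_)
  filter_upwards [eventually_hasDerivAt_comp_line v hf, hg] with t ht ht' using ht.unique ht'

theorem IsLocalMax.iteratedFDeriv_two_nonpos {f : E → ℝ} {y : E} (hmax : IsLocalMax f y)
    (hf : ContDiffAt ℝ 2 f y) (v : E) : iteratedFDeriv ℝ 2 f y ![v, v] ≤ 0 := by
  by_contra! hpos
  set φ : ℝ → ℝ := fun t => f (y + t • v) with hφ
  have hev := eventually_hasDerivAt_comp_line v hf
  have hd : deriv φ =ᶠ[𝓝 0] fun t => fderiv ℝ f (y + t • v) v := by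
    filter_upwards [hev] with t ht using ht.deriv
  have hd2 : deriv (deriv φ) 0 = iteratedFDeriv ℝ 2 f y ![v, v] :=
    ((hasDerivAt_fderiv_comp_line v hf).congr_of_eventuallyEq hd).deriv
  have hc : ContinuousAt φ 0 := hev.self_of_nhds.continuousAt
  have hm : IsLocalMax φ 0 := by
    have h2 : Tendsto (fun t : ℝ => y + t • v) (𝓝 0) (𝓝 y) := by
      simpa using (hasDerivAt_line y v 0).continuousAt.tendsto
    have := h2.eventually hmax
    simpa [IsLocalMax, IsMaxFilter, hφ] using this
  have hmin : IsLocalMin φ 0 := isLocalMin_of_deriv_deriv_pos (by rw [hd2]; exact hpos)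
    hm.deriv_eq_zero hc
  have hconst : φ =ᶠ[𝓝 0] fun _ => φ 0 := by
    filter_upwards [hm, hmin] with t h1 h2 using le_antisymm h1 h2
  have h0 : deriv (deriv φ) 0 = 0 := by
    rw [hconst.deriv.deriv_eq]; simp
  linarith

theorem contDiff_quadratic (a b c d : ℝ) (e p : E) :
    ContDiff ℝ 2 fun y : E => a * ‖y - p‖ ^ 2 + b * ⟪e, y - p⟫ ^ 2 + c * ⟪e, y - p⟫ + d := by
  have h1 : ContDiff ℝ 2 fun y : E => ‖y - p‖ ^ 2 := (contDiff_id.sub contDiff_const).norm_sq ℝ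
  have h2 : ContDiff ℝ 2 fun y : E => ⟪e, y - p⟫ :=
    contDiff_const.inner ℝ (contDiff_id.sub contDiff_const)
  fun_prop

theorem norm_line_sub_sq (y v p : E) (hv : ‖v‖ = 1) (t : ℝ) :
    ‖y + t • v - p‖ ^ 2 = ‖y - p‖ ^ 2 + 2 * t * ⟪y - p, v⟫ + t ^ 2 := by
  rw [show y + t • v - p = (y - p) + t • v by abel, norm_add_sq_real, inner_smul_right, norm_smul,
    hv, mul_one, Real.norm_eq_abs, sq_abs]
  ring

theorem inner_line_sub (e y v p : E) (t : ℝ) :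
    ⟪e, y + t • v - p⟫ = ⟪e, y - p⟫ + t * ⟪e, v⟫ := by
  rw [show y + t • v - p = (y - p) + t • v by abel, inner_add_right, inner_smul_right]

/-- The product of an affine function and a Gaussian, cut off so as to vanish on a sphere. -/
def gaussBarrier (e x p : E) (a K : ℝ) (y : E) : ℝ :=
  ⟪e, y - x⟫ * (Real.exp (-a * ‖y - p‖ ^ 2) - K)

theorem contDiff_gaussBarrier (e x p : E) (a K : ℝ) : ContDiff ℝ 2 (gaussBarrier e x p a K) := by
  have h1 : ContDiff ℝ 2 fun y : E => ‖y - p‖ ^ 2 := (contDiff_id.sub contDiff_const).norm_sq ℝ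
  have h2 : ContDiff ℝ 2 fun y : E => ⟪e, y - x⟫ :=
    contDiff_const.inner ℝ (contDiff_id.sub contDiff_const)
  unfold gaussBarrier
  fun_prop

variable [FiniteDimensional ℝ E]

theorem laplacian_eq_sum_of_line {f : E → ℝ} {y : E} (hf : ContDiffAt ℝ 2 f y) {k : E → ℝ}
    (h : ∀ v : E, ‖v‖ = 1 → ∃ g : ℝ → ℝ,
      (∀ t, HasDerivAt (fun t : ℝ => f (y + t • v)) (g t) t) ∧ HasDerivAt g (k v) 0) :
    Δ f y = ∑ i, k (stdOrthonormalBasis ℝ E i) := by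
  rw [InnerProductSpace.laplacian_eq_iteratedFDeriv_stdOrthonormalBasis]
  refine Finset.sum_congr rfl fun i _ => ?_
  obtain ⟨g, hg, hk⟩ := h (stdOrthonormalBasis ℝ E i) (by simp)
  exact iteratedFDeriv_two_eq_of_line hf (.of_forall hg) hk

theorem IsLocalMax.laplacian_nonpos {f : E → ℝ} {y : E} (hmax : IsLocalMax f y)
    (hf : ContDiffAt ℝ 2 f y) : Δ f y ≤ 0 := by
  rw [InnerProductSpace.laplacian_eq_iteratedFDeriv_stdOrthonormalBasis]
  exact Finset.sum_nonpos fun i _ => hmax.iteratedFDeriv_two_nonpos hf _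

theorem sum_inner_mul_inner_stdOrthonormalBasis (x y : E) :
    ∑ i, ⟪x, stdOrthonormalBasis ℝ E i⟫ * ⟪y, stdOrthonormalBasis ℝ E i⟫ = ⟪x, y⟫ := by
  rw [← (stdOrthonormalBasis ℝ E).sum_inner_mul_inner x y]
  simp_rw [real_inner_comm y]

theorem laplacian_quadratic (a b c d : ℝ) (e p y : E) :
    Δ (fun y : E => a * ‖y - p‖ ^ 2 + b * ⟪e, y - p⟫ ^ 2 + c * ⟪e, y - p⟫ + d) y =
      2 * finrank ℝ E * a + 2 * b * ‖e‖ ^ 2 := by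
  rw [laplacian_eq_sum_of_line (k := fun v => 2 * a + 2 * b * (⟪e, v⟫ * ⟪e, v⟫))
    (contDiff_quadratic a b c d e p).contDiffAt]
  · rw [Finset.sum_add_distrib, ← Finset.mul_sum, ← Finset.mul_sum, sum_inner_mul_inner_stdOrthonormalBasis,
      real_inner_self_eq_norm_sq]
    simp; ring
  · intro v hv
    refine ⟨fun t => a * (2 * ⟪y - p, v⟫ + 2 * t) +
      b * (2 * (⟪e, y - p⟫ + t * ⟪e, v⟫) * ⟪e, v⟫) + c * ⟪e, v⟫, fun t => ?_, ?_⟩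
    · simp_rw [norm_line_sub_sq y v p hv, inner_line_sub]
      have ht := hasDerivAt_id' t
      have h1 := ((ht.const_mul 2).mul_const ⟪y - p, v⟫).const_add (‖y - p‖ ^ 2)
      have h2 := (ht.mul_const ⟪e, v⟫).const_add ⟪e, y - p⟫
      refine (((((h1.add (ht.pow 2)).const_mul a).add ((h2.pow 2).const_mul b)).add
        (h2.const_mul c)).add_const d).congr_deriv ?_
      norm_num
    · have ht := hasDerivAt_id' (0 : ℝ)
      have h2 := (ht.mul_const ⟪e, v⟫).const_add ⟪e, y - p⟫
      refine (((((ht.const_mul 2).const_add (2 * ⟪y - p, v⟫)).const_mul a).add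
        (((h2.const_mul 2).mul_const ⟪e, v⟫).const_mul b)).add_const
          (c * ⟪e, v⟫)).congr_deriv ?_
      ring

theorem laplacian_gaussBarrier (e x p : E) (a K : ℝ) (y : E) :
    Δ (gaussBarrier e x p a K) y = Real.exp (-a * ‖y - p‖ ^ 2) *
      (-4 * a * ⟪e, y - p⟫ +
        ⟪e, y - x⟫ * (4 * a ^ 2 * ‖y - p‖ ^ 2 - 2 * a * finrank ℝ E)) := by
  rw [laplacian_eq_sum_of_line (k := fun v => Real.exp (-a * ‖y - p‖ ^ 2) *
    (-4 * a * (⟪e, v⟫ * ⟪y - p, v⟫) +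
        ⟪e, y - x⟫ * (4 * a ^ 2 * (⟪y - p, v⟫ * ⟪y - p, v⟫) - 2 * a)))
    (contDiff_gaussBarrier e x p a K).contDiffAt]
  · rw [← Finset.mul_sum, Finset.sum_add_distrib, ← Finset.mul_sum, ← Finset.mul_sum,
      Finset.sum_sub_distrib, ← Finset.mul_sum, sum_inner_mul_inner_stdOrthonormalBasis,
      sum_inner_mul_inner_stdOrthonormalBasis, real_inner_self_eq_norm_sq]
    simp; ring_nf; simp
  · intro v hv
    unfold gaussBarrier
    have hexp : ∀ t : ℝ, HasDerivAt
        (fun t : ℝ => Real.exp (-a * (‖y - p‖ ^ 2 + 2 * t * ⟪y - p, v⟫ + t ^ 2)))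
        (Real.exp (-a * (‖y - p‖ ^ 2 + 2 * t * ⟪y - p, v⟫ + t ^ 2)) *
          (-a * (2 * ⟪y - p, v⟫ + 2 * t))) t := by
      intro t
      have ht := hasDerivAt_id' t
      have h1 := ((ht.const_mul 2).mul_const ⟪y - p, v⟫).const_add (‖y - p‖ ^ 2)
      refine ((h1.add (ht.pow 2)).const_mul (-a)).exp.congr_deriv ?_
      simp
    have hin : ∀ t : ℝ, HasDerivAt (fun t : ℝ => ⟪e, y - x⟫ + t * ⟪e, v⟫) ⟪e, v⟫ t := by
      intro t
      simpa using ((hasDerivAt_id' t).mul_const ⟪e, v⟫).const_add ⟪e, y - x⟫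
    simp_rw [norm_line_sub_sq y v p hv, inner_line_sub]
    refine ⟨_, fun t => (hin t).mul ((hexp t).sub_const K), ?_⟩
    · have h3 : HasDerivAt (fun t : ℝ => -a * (2 * ⟪y - p, v⟫ + 2 * t)) (-a * 2) 0 := by
        simpa using (((hasDerivAt_id' (0 : ℝ)).const_mul 2).const_add
          (2 * ⟪y - p, v⟫)).const_mul (-a)
      refine ((((hexp 0).sub_const K).const_mul ⟪e, v⟫).add
        ((hin 0).mul ((hexp 0).mul h3))).congr_deriv ?_
      simp; ring

/-- The weak maximum principle for subharmonic functions. -/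
theorem nonpos_of_laplacian_nonneg [Nontrivial E] {U : Set E} (hU : IsOpen U) (hb : IsBounded U)
    {v : E → ℝ} (hc : ContinuousOn v (closure U)) (hs : ∀ y ∈ U, ContDiffAt ℝ 2 v y)
    (hl : ∀ y ∈ U, 0 ≤ Δ v y) (hf : ∀ y ∈ frontier U, v y ≤ 0) : ∀ y ∈ U, v y ≤ 0 := by
  intro z hz
  by_contra! hpos
  obtain ⟨R, hR⟩ := hb.closure.exists_norm_le
  set ε : ℝ := v z / (2 * (R ^ 2 + 1)) with hε
  have hε0 : 0 < ε := by positivity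
  set q : E → ℝ := fun y => ε * ‖y - 0‖ ^ 2 + 0 * ⟪(0 : E), y - 0⟫ ^ 2 + 0 * ⟪(0 : E), y - 0⟫ +
    -(ε * R ^ 2) with hq
  have hqs : ContDiff ℝ 2 q := contDiff_quadratic _ _ _ _ _ _
  have hqle : ∀ y ∈ closure U, q y ≤ 0 := by
    intro y hy
    have h1 : ‖y‖ ^ 2 ≤ R ^ 2 := pow_le_pow_left₀ (norm_nonneg y) (hR y hy) 2
    simp only [hq, sub_zero, zero_mul, add_zero]
    nlinarith
  have hqz : 0 < v z + q z := by
    have h1 : ε * R ^ 2 < v z := by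
      rw [hε, div_mul_eq_mul_div, div_lt_iff₀ (by positivity)]
      nlinarith [sq_nonneg R]
    simp only [hq, sub_zero, zero_mul, add_zero]
    nlinarith [sq_nonneg ‖z‖, mul_nonneg hε0.le (sq_nonneg ‖z‖)]
  obtain ⟨y, hy, hmax⟩ := hb.isCompact_closure.exists_isMaxOn ⟨z, subset_closure hz⟩
    (hc.add hqs.continuous.continuousOn)
  have hzy : v z + q z ≤ v y + q y := hmax (subset_closure hz)
  have hyU : y ∈ U := by
    by_contra hyU
    have h1 := hf y ⟨hy, by rwa [hU.interior_eq]⟩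
    linarith [hqle y hy]
  have hloc : IsLocalMax (v + q) y :=
    (hmax.on_subset subset_closure).isLocalMax (hU.mem_nhds hyU)
  have h1 := hloc.laplacian_nonpos ((hs y hyU).add hqs.contDiffAt)
  rw [(hs y hyU).laplacian_add hqs.contDiffAt, laplacian_quadratic] at h1
  have h2 := hl y hyU
  have h3 : (0 : ℝ) < finrank ℝ E := by exact_mod_cast finrank_pos
  have h4 := mul_pos h3 hε0
  simp at h1
  nlinarith

theorem laplacian_comp_isometry {v : E → ℝ} (σ : E ≃ₗᵢ[ℝ] E) (p y : E)
    (hv : ContDiffAt ℝ 2 v (p + σ (y - p))) :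
    Δ (fun y => v (p + σ (y - p))) y = Δ v (p + σ (y - p)) := by
  rw [InnerProductSpace.laplacian_eq_iteratedFDeriv_stdOrthonormalBasis,
    InnerProductSpace.laplacian_eq_iteratedFDeriv_orthonormalBasis v
      ((stdOrthonormalBasis ℝ E).map σ)]
  refine Finset.sum_congr rfl fun i _ => ?_
  set b := stdOrthonormalBasis ℝ E i
  have hσ : ContDiff ℝ 2 fun y => p + σ (y - p) :=
    contDiff_const.add (σ.contDiff.comp (contDiff_id.sub contDiff_const))
  have hline : ∀ t : ℝ, p + σ (y + t • b - p) = p + σ (y - p) + t • σ b := by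
    intro t
    rw [show y + t • b - p = (y - p) + t • b by abel, map_add, map_smul, add_assoc]
  refine iteratedFDeriv_two_eq_of_line (hv.comp y hσ.contDiffAt)
    (g := fun t => fderiv ℝ v (p + σ (y - p) + t • σ b) (σ b)) ?_ ?_
  · simp only [Function.comp_def, hline]
    exact eventually_hasDerivAt_comp_line (σ b) hv
  · simpa using hasDerivAt_fderiv_comp_line (σ b) hv

theorem HasDerivAt.nonpos_of_eventually_le {F : ℝ → ℝ} {F' : ℝ} (h : HasDerivAt F F' 0)
    (h0 : F 0 = 0) (hle : ∀ᶠ t in 𝓝[>] 0, F t ≤ 0) : F' ≤ 0 := by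
  have h1 : Tendsto (slope F 0) (𝓝[>] 0) (𝓝 F') :=
    (hasDerivAt_iff_tendsto_slope.1 h).mono_left (nhdsWithin_mono 0 fun t (ht : 0 < t) => ht.ne')
  refine le_of_tendsto h1 ?_
  filter_upwards [hle, self_mem_nhdsWithin] with t ht ht0
  rw [slope_def_field, h0]
  exact div_nonpos_of_nonpos_of_nonneg (by linarith) (by linarith [mem_Ioi.1 ht0])

/-- Interior derivative bound for harmonic functions in a fixed direction. -/
theorem fderiv_apply_le_of_harmonic [Nontrivial E] {v : E → ℝ} {p e : E} {d N : ℝ} (hd : 0 < d)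
    (he : ‖e‖ = 1) (hs : ∀ y ∈ closedBall p d, ContDiffAt ℝ 2 v y)
    (hl : ∀ y ∈ closedBall p d, Δ v y = 0) (hN : ∀ y ∈ closedBall p d, |v y| ≤ N) :
    fderiv ℝ v p e ≤ finrank ℝ E * N / d := by
  set n : ℝ := ((finrank ℝ E : ℕ) : ℝ) with hn
  have hn1 : 1 ≤ n := by
    have : 1 ≤ finrank ℝ E := finrank_pos
    rw [hn]
    exact_mod_cast this
  have hN0 : 0 ≤ N := (abs_nonneg _).trans (hN p (mem_closedBall_self hd.le))
  set σ : E ≃ₗᵢ[ℝ] E := (ℝ ∙ e)ᗮ.reflection with hσ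
  have hσe : σ e = -e := Submodule.reflection_orthogonalComplement_singleton_eq_neg e
  have hσ0 : ∀ z, ⟪e, z⟫ = 0 → σ z = z := fun z hz =>
    Submodule.reflection_mem_subspace_eq_self
      (Submodule.mem_orthogonal_singleton_iff_inner_right.2 hz)
  have hσball : ∀ y ∈ closedBall p d, p + σ (y - p) ∈ closedBall p d := by
    intro y hy
    rw [mem_closedBall, dist_eq_norm] at hy ⊢
    rwa [add_sub_cancel_left, σ.norm_map]
  have hσs : ContDiff ℝ 2 fun y => p + σ (y - p) :=
    contDiff_const.add (σ.contDiff.comp (contDiff_id.sub contDiff_const))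
  set w : E → ℝ := fun y => v (p + σ (y - p)) with hw
  have hws : ∀ y ∈ closedBall p d, ContDiffAt ℝ 2 w y := fun y hy =>
    (hs _ (hσball y hy)).comp y hσs.contDiffAt
  have hwl : ∀ y ∈ closedBall p d, Δ w y = 0 := fun y hy =>
    (laplacian_comp_isometry σ p y (hs _ (hσball y hy))).trans (hl _ (hσball y hy))
  set c : ℝ := 2 * N / d ^ 2 with hc
  have hc0 : 0 ≤ c := by positivity
  set ψ : E → ℝ := fun y => c * ‖y - p‖ ^ 2 + -(n * c) * ⟪e, y - p⟫ ^ 2 +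
    (n * d * c) * ⟪e, y - p⟫ + 0 with hψ
  have hψs : ContDiff ℝ 2 ψ := contDiff_quadratic _ _ _ _ _ _
  have hψl : ∀ y, Δ ψ y = 0 := by
    intro y
    rw [hψ, laplacian_quadratic, he]; ring
  have hinner : Continuous fun y : E => ⟪e, y - p⟫ := by fun_prop
  set U : Set E := ball p d ∩ {y | 0 < ⟪e, y - p⟫} with hU
  have hUo : IsOpen U := isOpen_ball.inter (isOpen_lt continuous_const hinner)
  have hUc : closure U ⊆ closedBall p d ∩ {y | 0 ≤ ⟪e, y - p⟫} :=
    closure_minimal (inter_subset_inter ball_subset_closedBall fun y (hy : 0 < ⟪e, y - p⟫) => hy.le)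
      (isClosed_closedBall.inter (isClosed_le continuous_const hinner))
  have key : ∀ y ∈ U, (v - w - ψ) y ≤ 0 := by
    refine nonpos_of_laplacian_nonneg hUo (isBounded_ball.subset inter_subset_left) ?_ ?_ ?_ ?_
    · intro y hy
      have hy' := (hUc hy).1
      exact (((hs y hy').sub (hws y hy')).sub hψs.contDiffAt).continuousAt.continuousWithinAt
    · intro y hy
      have hy' := (hUc (subset_closure hy)).1
      exact ((hs y hy').sub (hws y hy')).sub hψs.contDiffAt
    · intro y hy
      have hy' := (hUc (subset_closure hy)).1
      have hvw : ContDiffAt ℝ 2 (v - w) y := (hs y hy').sub (hws y hy')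
      rw [hvw.laplacian_sub hψs.contDiffAt, (hs y hy').laplacian_sub (hws y hy'), hl y hy', hwl y hy', hψl]
      simp
    · intro y hy
      obtain ⟨hyd, hye⟩ := hUc hy.1
      have hyU : y ∉ U := by simpa [hUo.interior_eq] using hy.2
      change 0 ≤ ⟪e, y - p⟫ at hye
      rw [Pi.sub_apply, Pi.sub_apply]
      rcases hye.eq_or_lt with h0 | h0
      · have h1 : w y = v y := by
          simp only [hw, hσ0 _ h0.symm, add_sub_cancel]
        have h2 : ψ y = c * ‖y - p‖ ^ 2 := by simp [hψ, ← h0]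
        rw [h1, h2]
        nlinarith [mul_nonneg hc0 (sq_nonneg ‖y - p‖)]
      · have h1 : ‖y - p‖ = d := by
          refine le_antisymm (by simpa [dist_eq_norm] using hyd) ?_
          by_contra! h
          exact hyU ⟨by simpa [dist_eq_norm] using h, h0⟩
        have h2 : ⟪e, y - p⟫ ≤ d := by
          simpa [he, h1] using real_inner_le_norm e (y - p)
        have h3 : ψ y = c * d ^ 2 + n * c * (⟪e, y - p⟫ * (d - ⟪e, y - p⟫)) := by
          simp only [hψ, h1]; ring
        have h4 : c * d ^ 2 = 2 * N := by rw [hc]; field_simp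
        have h5 : 0 ≤ n * c * (⟪e, y - p⟫ * (d - ⟪e, y - p⟫)) :=
          mul_nonneg (mul_nonneg (by linarith) hc0) (mul_nonneg hye (by linarith))
        have h6 := (abs_le.1 (hN y hyd)).2
        have h7 := (abs_le.1 (hN _ (hσball y hyd))).1
        change -N ≤ w y at h7
        linarith
  have hp : p ∈ closedBall p d := mem_closedBall_self hd.le
  have hvd := ((hs p hp).differentiableAt (by simp)).hasFDerivAt
  have hd1 : HasDerivAt (fun t : ℝ => v (p + t • e)) (fderiv ℝ v p e) 0 := by
    have h1 : HasFDerivAt v (fderiv ℝ v p) (p + (0 : ℝ) • e) := by simpa using hvd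
    exact h1.comp_hasDerivAt 0 (hasDerivAt_line p e 0)
  have hd2 : HasDerivAt (fun t : ℝ => v (p + t • -e)) (fderiv ℝ v p (-e)) 0 := by
    have h1 : HasFDerivAt v (fderiv ℝ v p) (p + (0 : ℝ) • -e) := by simpa using hvd
    exact h1.comp_hasDerivAt 0 (hasDerivAt_line p (-e) 0)
  have hd3 : HasDerivAt (fun t : ℝ => (c - n * c) * t ^ 2 + n * d * c * t) (n * d * c) 0 := by
    simpa using (((hasDerivAt_id' (0 : ℝ)).fun_pow 2).const_mul (c - n * c)).fun_add
      ((hasDerivAt_id' (0 : ℝ)).const_mul (n * d * c))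
  have hfin := ((hd1.sub hd2).sub hd3).nonpos_of_eventually_le (by simp) (by
    filter_upwards [Ioo_mem_nhdsGT hd] with t ht
    have htU : p + t • e ∈ U := by
      refine ⟨?_, ?_⟩
      · simpa [dist_eq_norm, norm_smul, he, abs_of_pos ht.1] using ht.2
      · simpa [inner_smul_right, he] using ht.1
    have h1 := key _ htU
    have h2 : w (p + t • e) = v (p + t • -e) := by simp [hw, hσe]
    have h3 : ψ (p + t • e) = (c - n * c) * t ^ 2 + n * d * c * t := by
      simp [hψ, inner_smul_right, norm_smul, he]; ring
    rw [Pi.sub_apply, Pi.sub_apply, h2, h3] at h1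
    exact h1)
  rw [map_neg] at hfin
  have h1 : n * d * c = 2 * (n * N / d) := by rw [hc]; field_simp
  linarith

/-- Interior gradient bound for harmonic functions. -/
theorem norm_fderiv_le_of_harmonic [Nontrivial E] {v : E → ℝ} {p : E} {d N : ℝ} (hd : 0 < d)
    (hs : ∀ y ∈ closedBall p d, ContDiffAt ℝ 2 v y)
    (hl : ∀ y ∈ closedBall p d, Δ v y = 0) (hN : ∀ y ∈ closedBall p d, |v y| ≤ N) :
    ‖fderiv ℝ v p‖ ≤ finrank ℝ E * N / d := by
  have hN0 : 0 ≤ N := (abs_nonneg _).trans (hN p (mem_closedBall_self hd.le))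
  have key : ∀ x : E, fderiv ℝ v p x ≤ finrank ℝ E * N / d * ‖x‖ := by
    intro x
    rcases eq_or_ne x 0 with rfl | hx
    · simp
    · have h1 := fderiv_apply_le_of_harmonic hd (norm_smul_inv_norm (𝕜 := ℝ) hx) hs hl hN
      have h2 : 0 < ‖x‖ := norm_pos_iff.2 hx
      rw [map_smul, smul_eq_mul] at h1
      simpa [h2.ne'] using (inv_mul_le_iff₀' h2).1 h1
  refine ContinuousLinearMap.opNorm_le_bound _ (by positivity) fun x => ?_
  rw [Real.norm_eq_abs, abs_le']
  refine ⟨key x, ?_⟩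
  simpa using key (-x)

section Support

theorem hasFDerivAt_inner_sub {E : Type*} [NormedAddCommGroup E] [InnerProductSpace ℝ E]
    (e x₀ p : E) : HasFDerivAt (fun y : E => ⟪e, y - x₀⟫) (innerSL ℝ e) p :=
  (innerSL ℝ e).hasFDerivAt.comp p ((hasFDerivAt_id p).sub_const x₀)

variable {Ω : Set E} {h : E → ℝ} {e x₀ : E}

/-- `h` is harmonic in `Ω`, the half-space `{⟪e, y - x₀⟫ > 0}` contains `Ω`, and `h` agrees with
the square of the distance to its bounding hyperplane on the boundary of `Ω`. -/
structure IsHalfSpaceHarmonic (Ω : Set E) (h : E → ℝ) (e x₀ : E) : Prop where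
  isOpen : IsOpen Ω
  isBounded : IsBounded Ω
  norm_normal : ‖e‖ = 1
  inner_pos : ∀ y ∈ Ω, 0 < ⟪e, y - x₀⟫
  continuousOn : ContinuousOn h (closure Ω)
  contDiffAt : ∀ y ∈ Ω, ContDiffAt ℝ 2 h y
  laplacian_eq : ∀ y ∈ Ω, Δ h y = 0
  frontier_eq : ∀ y ∈ frontier Ω, h y = ⟪e, y - x₀⟫ ^ 2

/-- The function `m ⟪e, y - x₀⟫ - h y`. -/
def linearGap (h : E → ℝ) (e x₀ : E) (m : ℝ) (y : E) : ℝ := m * ⟪e, y - x₀⟫ - h y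

namespace IsHalfSpaceHarmonic

theorem inner_nonneg (H : IsHalfSpaceHarmonic Ω h e x₀) {y : E} (hy : y ∈ closure Ω) :
    0 ≤ ⟪e, y - x₀⟫ := by
  have hcl : IsClosed {y : E | 0 ≤ ⟪e, y - x₀⟫} := isClosed_le continuous_const (by fun_prop)
  exact closure_minimal (fun z hz => (H.inner_pos z hz).le) hcl hy

theorem inner_le (H : IsHalfSpaceHarmonic Ω h e x₀) (y : E) : ⟪e, y - x₀⟫ ≤ ‖y - x₀‖ := by
  simpa [H.norm_normal] using real_inner_le_norm e (y - x₀)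

omit [FiniteDimensional ℝ E] in
theorem linearGap_eq (m : ℝ) : linearGap h e x₀ m =
    (fun y => 0 * ‖y - x₀‖ ^ 2 + 0 * ⟪e, y - x₀⟫ ^ 2 + m * ⟪e, y - x₀⟫ + 0) - h := by
  ext y; simp [linearGap]

theorem contDiffAt_linearGap (H : IsHalfSpaceHarmonic Ω h e x₀) (m : ℝ) {y : E} (hy : y ∈ Ω) :
    ContDiffAt ℝ 2 (linearGap h e x₀ m) y := by
  rw [linearGap_eq]
  exact (contDiff_quadratic _ _ _ _ _ _).contDiffAt.sub (H.contDiffAt y hy)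

theorem laplacian_linearGap (H : IsHalfSpaceHarmonic Ω h e x₀) (m : ℝ) {y : E} (hy : y ∈ Ω) :
    Δ (linearGap h e x₀ m) y = 0 := by
  rw [linearGap_eq, (contDiff_quadratic _ _ _ _ _ _).contDiffAt.laplacian_sub (H.contDiffAt y hy),
    laplacian_quadratic, H.laplacian_eq y hy]
  simp

theorem continuousOn_linearGap (H : IsHalfSpaceHarmonic Ω h e x₀) (m : ℝ) :
    ContinuousOn (linearGap h e x₀ m) (closure Ω) := by
  rw [linearGap_eq]
  exact (contDiff_quadratic _ _ _ _ _ _).continuous.continuousOn.sub H.continuousOn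

theorem linearGap_of_frontier (H : IsHalfSpaceHarmonic Ω h e x₀) (m : ℝ) {y : E}
    (hy : y ∈ frontier Ω) : linearGap h e x₀ m y = ⟪e, y - x₀⟫ * (m - ⟪e, y - x₀⟫) := by
  rw [linearGap, H.frontier_eq y hy]; ring

theorem laplacian_gaussBarrier_nonneg (H : IsHalfSpaceHarmonic Ω h e x₀) {A l K ρ : ℝ}
    (hA : 0 ≤ A) (hl : 0 ≤ l) (hlρ : 2 * l * ρ ^ 2 = finrank ℝ E + 2) (hρ : 0 ≤ ρ) {p y : E}
    (hp : p ∈ Ω) (hy : y ∈ Ω) (hyp : ρ ≤ ‖y - p‖) :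
    0 ≤ Δ (gaussBarrier (A • e) x₀ p l K) y := by
  rw [laplacian_gaussBarrier]
  refine mul_nonneg (Real.exp_pos _).le ?_
  rw [inner_smul_left, inner_smul_left, RCLike.conj_to_real]
  have h1 : ⟪e, y - p⟫ = ⟪e, y - x₀⟫ - ⟪e, p - x₀⟫ := by
    rw [← inner_sub_right]; congr 1; abel
  have h2 := H.inner_pos y hy
  have h3 := H.inner_pos p hp
  have h4 : ρ ^ 2 ≤ ‖y - p‖ ^ 2 := pow_le_pow_left₀ hρ hyp 2
  have h5 : finrank ℝ E + 2 ≤ 2 * l * ‖y - p‖ ^ 2 := by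
    rw [← hlρ]; gcongr
  have h6 : -4 * l * (A * ⟪e, y - p⟫) + A * ⟪e, y - x₀⟫ *
      (4 * l ^ 2 * ‖y - p‖ ^ 2 - 2 * l * finrank ℝ E) = A * l * (4 * ⟪e, p - x₀⟫ +
        2 * (⟪e, y - x₀⟫ * (2 * l * ‖y - p‖ ^ 2 - (finrank ℝ E + 2)))) := by
    rw [h1]; ring
  rw [h6]
  have h7 : 0 ≤ ⟪e, y - x₀⟫ * (2 * l * ‖y - p‖ ^ 2 - (finrank ℝ E + 2)) :=
    mul_nonneg h2.le (by linarith)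
  have : 0 ≤ A * l := mul_nonneg hA hl
  exact mul_nonneg this (by linarith)

theorem le_inner_of_ball_subset (H : IsHalfSpaceHarmonic Ω h e x₀) {d : ℝ} {p : E} (hp : p ∈ Ω)
    (hpΩ : ball p d ⊆ Ω) : d ≤ ⟪e, p - x₀⟫ := by
  by_contra! hlt
  have hpos := H.inner_pos p hp
  have hmem : p - ⟪e, p - x₀⟫ • e ∈ Ω :=
    hpΩ (by simpa [dist_eq_norm, norm_smul, H.norm_normal, abs_of_pos hpos] using hlt)
  have h1 := H.inner_pos _ hmem
  rw [sub_right_comm, inner_sub_right, inner_smul_right, real_inner_self_eq_norm_sq,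
    H.norm_normal] at h1
  simp at h1

variable [Nontrivial E]

theorem nonneg (H : IsHalfSpaceHarmonic Ω h e x₀) {y : E} (hy : y ∈ Ω) : 0 ≤ h y := by
  have key := nonpos_of_laplacian_nonneg H.isOpen H.isBounded (H.continuousOn_linearGap 0)
    (fun y hy => H.contDiffAt_linearGap 0 hy) (fun y hy => (H.laplacian_linearGap 0 hy).ge)
    (fun y hy => by
      rw [H.linearGap_of_frontier 0 hy]
      nlinarith [sq_nonneg ⟪e, y - x₀⟫]) y hy
  simpa [linearGap] using key

theorem exists_le_mul_inner (H : IsHalfSpaceHarmonic Ω h e x₀) :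
    ∃ D, 0 ≤ D ∧ ∀ y ∈ Ω, h y ≤ D * ⟪e, y - x₀⟫ := by
  obtain ⟨R, hR⟩ := H.isBounded.closure.exists_norm_le
  set D := |R| + ‖x₀‖
  have hD : ∀ y ∈ closure Ω, ⟪e, y - x₀⟫ ≤ D := fun y hy =>
    (H.inner_le y).trans ((norm_sub_le _ _).trans
      (add_le_add_left ((hR y hy).trans (le_abs_self R)) _))
  refine ⟨D, by positivity, fun y hy => ?_⟩
  have key := nonpos_of_laplacian_nonneg (v := -linearGap h e x₀ D) H.isOpen H.isBounded
    (H.continuousOn_linearGap D).neg (fun y hy => (H.contDiffAt_linearGap D hy).neg)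
    (fun y hy => by
      rw [InnerProductSpace.laplacian_neg, Pi.neg_apply, H.laplacian_linearGap D hy]; simp)
    (fun y hy => by
      rw [Pi.neg_apply, H.linearGap_of_frontier D hy]
      have h1 := hD y hy.1
      have h2 := H.inner_nonneg hy.1
      nlinarith) y hy
  simp only [Pi.neg_apply, linearGap] at key
  linarith

/-- A lower bound for `linearGap` at a point away from the boundary propagates to a ball. -/
theorem le_linearGap_of_mem_closedBall (H : IsHalfSpaceHarmonic Ω h e x₀) {a r m M s θ : ℝ}
    (ha : 0 < a) (ha1 : a ≤ 1) (hr : 0 < r) (hM : 0 < M) (hmM : m ≤ M) (hθ : θ ≤ a / 2)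
    (hθs : 8 * finrank ℝ E * M / a * θ * r ≤ s) {p : E} (hp : ‖p - x₀‖ = r)
    (hpΩ : ball p (a * r) ⊆ Ω)
    (hm : ∀ y ∈ Ω, ‖y - x₀‖ < 5 * r → h y ≤ m * ⟪e, y - x₀⟫) :
    ∀ y ∈ closedBall p (θ * r), linearGap h e x₀ m p - s ≤ linearGap h e x₀ m y := by
  have har : 0 < a * r := by positivity
  have har1 : a * r ≤ r := by nlinarith
  have hball : ∀ z ∈ closedBall p (a * r / 2), ∀ y ∈ closedBall z (a * r / 4),
      y ∈ Ω ∧ ‖y - x₀‖ ≤ 2 * r := by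
    intro z hz y hy
    rw [mem_closedBall] at hz hy
    have h1 : dist y p ≤ 3 / 4 * (a * r) := by linarith [dist_triangle y z p]
    refine ⟨hpΩ (mem_ball.2 (by linarith)), ?_⟩
    rw [← dist_eq_norm] at hp ⊢
    linarith [dist_triangle y p x₀]
  have hgrad : ∀ z ∈ closedBall p (a * r / 2),
      ‖fderiv ℝ (linearGap h e x₀ m) z‖ ≤ 8 * finrank ℝ E * M / a := by
    intro z hz
    have h1 := norm_fderiv_le_of_harmonic (v := linearGap h e x₀ m) (p := z) (d := a * r / 4)
      (N := 2 * M * r) (by positivity)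
      (fun y hy => H.contDiffAt_linearGap m (hball z hz y hy).1)
      (fun y hy => H.laplacian_linearGap m (hball z hz y hy).1)
      (fun y hy => by
        obtain ⟨hyΩ, hyr⟩ := hball z hz y hy
        have h2 := hm y hyΩ (by linarith)
        have h3 := H.nonneg hyΩ
        have h4 := (H.inner_le y).trans hyr
        have h5 := H.inner_pos y hyΩ
        rw [linearGap, abs_le]
        constructor <;> nlinarith)
    refine h1.trans_eq ?_
    field_simp
    ring
  intro y hy
  rw [mem_closedBall, dist_eq_norm] at hy
  have hy2 : y ∈ closedBall p (a * r / 2) := by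
    rw [mem_closedBall, dist_eq_norm]
    nlinarith
  have h1 := (convex_closedBall p (a * r / 2)).norm_image_sub_le_of_norm_fderiv_le
    (f := linearGap h e x₀ m) (𝕜 := ℝ)
    (fun z hz => (H.contDiffAt_linearGap m
      (hball z hz z (mem_closedBall_self (by positivity))).1).differentiableAt (by simp))
    hgrad (mem_closedBall_self (by positivity)) hy2
  have h2 : 8 * finrank ℝ E * M / a * ‖y - p‖ ≤ s := by
    refine le_trans ?_ hθs
    rw [mul_assoc _ θ r]
    gcongr
  have h3 := (abs_le.1 (h1.trans h2)).1
  linarith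

/-- Comparison of `linearGap` with a Gaussian barrier in an annulus. -/
theorem mul_exp_le_linearGap (H : IsHalfSpaceHarmonic Ω h e x₀) {A l ρ R m : ℝ} {p : E}
    (hA : 0 ≤ A) (hl : 0 ≤ l) (hlρ : 2 * l * ρ ^ 2 = finrank ℝ E + 2) (hρ : 0 ≤ ρ) (hp : p ∈ Ω)
    (hinner : ∀ y ∈ Ω, dist y p = ρ → A * ⟪e, y - x₀⟫ ≤ linearGap h e x₀ m y)
    (houter : ∀ y ∈ Ω, dist y p = R → 0 ≤ linearGap h e x₀ m y)
    (hfront : ∀ y ∈ frontier Ω, dist y p ≤ R → A * ⟪e, y - x₀⟫ ≤ linearGap h e x₀ m y) :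
    ∀ y ∈ Ω, ρ < dist y p → dist y p < R →
      A * ⟪e, y - x₀⟫ * (Real.exp (-l * dist y p ^ 2) - Real.exp (-l * R ^ 2)) ≤
        linearGap h e x₀ m y := by
  set K : ℝ := Real.exp (-l * R ^ 2) with hK
  set b : E → ℝ := gaussBarrier (A • e) x₀ p l K with hb
  have hb_eq : ∀ y, b y = A * ⟪e, y - x₀⟫ * (Real.exp (-l * dist y p ^ 2) - K) := by
    intro y
    rw [hb, gaussBarrier, inner_smul_left, RCLike.conj_to_real, dist_eq_norm]
  have hbs : ContDiff ℝ 2 b := contDiff_gaussBarrier _ _ _ _ _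
  have hK0 : 0 < K := Real.exp_pos _
  have hb_le : ∀ y ∈ closure Ω, b y ≤ A * ⟪e, y - x₀⟫ := by
    intro y hy
    have h1 : Real.exp (-l * dist y p ^ 2) ≤ 1 :=
      Real.exp_le_one_iff.2 (by nlinarith [sq_nonneg (dist y p)])
    rw [hb_eq]
    exact mul_le_of_le_one_right (mul_nonneg hA (H.inner_nonneg hy)) (by linarith)
  set U : Set E := Ω ∩ (ball p R ∩ {y | ρ < dist y p}) with hU
  have hUo : IsOpen U := H.isOpen.inter
    (isOpen_ball.inter (isOpen_lt continuous_const (by fun_prop)))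
  have hUc : closure U ⊆ closure Ω ∩ (closedBall p R ∩ {y | ρ ≤ dist y p}) := by
    have hcl : IsClosed {y | ρ ≤ dist y p} := isClosed_le continuous_const (by fun_prop)
    exact closure_minimal (inter_subset_inter subset_closure
      (inter_subset_inter ball_subset_closedBall fun y (hy : ρ < dist y p) => hy.le))
      (isClosed_closure.inter (isClosed_closedBall.inter hcl))
  have key : ∀ y ∈ U, (b - linearGap h e x₀ m) y ≤ 0 := by
    refine nonpos_of_laplacian_nonneg hUo (H.isBounded.subset inter_subset_left) ?_ ?_ ?_ ?_
    · exact hbs.continuous.continuousOn.sub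
        ((H.continuousOn_linearGap m).mono (hUc.trans inter_subset_left))
    · exact fun y hy => hbs.contDiffAt.sub (H.contDiffAt_linearGap m hy.1)
    · intro y hy
      rw [hbs.contDiffAt.laplacian_sub (H.contDiffAt_linearGap m hy.1),
        H.laplacian_linearGap m hy.1, sub_zero]
      refine H.laplacian_gaussBarrier_nonneg hA hl hlρ hρ hp hy.1 ?_
      rw [← dist_eq_norm]
      exact (hUc (subset_closure hy)).2.2
    · intro y hy
      obtain ⟨hyΩ, hyr, hyρ⟩ := hUc hy.1
      have hyU : y ∉ U := by simpa [hUo.interior_eq] using hy.2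
      change ρ ≤ dist y p at hyρ
      rw [mem_closedBall] at hyr
      rw [Pi.sub_apply, sub_nonpos]
      by_cases hyΩ' : y ∈ Ω
      · rcases hyρ.eq_or_lt with hyρ | hyρ
        · exact (hb_le y hyΩ).trans (hinner y hyΩ' hyρ.symm)
        · have h1 : dist y p = R := by
            refine le_antisymm hyr ?_
            by_contra! h
            exact hyU ⟨hyΩ', mem_ball.2 h, hyρ⟩
          have h2 : b y = 0 := by
            rw [hb_eq, h1, ← hK, sub_self, mul_zero]
          rw [h2]
          exact houter y hyΩ' h1
      · exact (hb_le y hyΩ).trans (hfront y ⟨hyΩ, by rwa [H.isOpen.interior_eq]⟩ hyr)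
  intro y hy hyρ hyR
  have h1 := key y ⟨hy, mem_ball.2 hyR, hyρ⟩
  rwa [Pi.sub_apply, sub_nonpos, hb_eq] at h1

/-- A Hopf-type comparison: a linear upper bound for `h` that is far from sharp at one point away
from the boundary can be improved near `x₀`, by an amount which does not depend on the scale. -/
theorem exists_improvement (H : IsHalfSpaceHarmonic Ω h e x₀) {a δ c : ℝ} (ha : 0 < a)
    (ha1 : a ≤ 1) (hδ : 0 < δ) (hc : 0 < c) :
    ∃ ε > 0, ∀ (m r : ℝ) (p : E), c ≤ m → m ≤ c + 1 → 0 < r → 10 * r ≤ c → ‖p - x₀‖ = r →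
      ball p (a * r) ⊆ Ω → a * r ≤ ⟪e, p - x₀⟫ →
      (∀ y ∈ Ω, ‖y - x₀‖ < 5 * r → h y ≤ m * ⟪e, y - x₀⟫) →
      h p ≤ (m - δ) * ⟪e, p - x₀⟫ →
      ∀ y ∈ Ω, ‖y - x₀‖ < r / 2 → h y ≤ (m - ε) * ⟪e, y - x₀⟫ := by
  have hn : (0 : ℝ) < finrank ℝ E := by exact_mod_cast finrank_pos
  set L : ℝ := 8 * finrank ℝ E * (c + 1) / a with hL
  have hL0 : 0 < L := by positivity
  set θ : ℝ := min (a / 2) (δ * a / (2 * L)) with hθ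
  have hθ0 : 0 < θ := lt_min (by positivity) (by positivity)
  have hθa : θ ≤ a / 2 := min_le_left _ _
  have hθL : L * θ ≤ δ * a / 2 := by
    have := (le_div_iff₀ (by positivity)).1 (min_le_right (a / 2) (δ * a / (2 * L)))
    linarith
  set μ : ℝ := (finrank ℝ E + 2) / (2 * θ ^ 2) with hμ
  have hμ0 : 0 < μ := by positivity
  set A : ℝ := min (δ * a / 4) (c / 2) with hA
  have hA0 : 0 < A := lt_min (by positivity) (by positivity)
  set κ : ℝ := Real.exp (-μ * (9 / 4)) - Real.exp (-μ * 9) with hκ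
  have hκ0 : 0 < κ := sub_pos.2 (Real.exp_lt_exp.2 (by linarith))
  refine ⟨A * κ, by positivity, ?_⟩
  intro m r p hcm hmc hr hrc hp hpΩ hpe hm hhp
  set ρ := θ * r with hρ
  have hρ0 : 0 < ρ := by positivity
  have hρr : ρ ≤ a * r / 2 := by nlinarith
  have hρr' : ρ ≤ r / 2 := by nlinarith
  have hpmem : p ∈ Ω := hpΩ (mem_ball_self (by positivity))
  set l : ℝ := μ / r ^ 2 with hl
  have hl0 : 0 < l := by positivity
  have hlr : l * r ^ 2 = μ := by rw [hl]; field_simp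
  have hlρ : 2 * l * ρ ^ 2 = finrank ℝ E + 2 := by
    rw [hl, hρ, hμ]; field_simp
  have hwp : δ * a * r ≤ linearGap h e x₀ m p := by
    rw [linearGap]
    nlinarith
  have hwball := H.le_linearGap_of_mem_closedBall (s := δ * a * r / 2) ha ha1 hr
    (by linarith : 0 < c + 1) hmc hθa (by rw [← hL]; nlinarith) hp hpΩ hm
  have hdist : ∀ y, ‖y - x₀‖ ≤ dist y p + r := by
    intro y
    rw [← hp, ← dist_eq_norm, ← dist_eq_norm]
    exact dist_triangle _ _ _
  have key := H.mul_exp_le_linearGap (A := A) (l := l) (ρ := ρ) (R := 3 * r) (m := m) (p := p)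
    hA0.le hl0.le hlρ hρ0.le hpmem
    (fun y hy hyρ => by
      have h1 := hwball y (mem_closedBall.2 hyρ.le)
      have h3 := H.inner_le y
      have h4 := hdist y
      have h5 : A * ⟪e, y - x₀⟫ ≤ δ * a / 4 * (2 * r) :=
        mul_le_mul (min_le_left _ _) (by linarith) (H.inner_pos y hy).le (by positivity)
      linarith)
    (fun y hy hyr => by
      have h1 := hm y hy (by linarith [hdist y])
      rw [linearGap]
      linarith)
    (fun y hy hyr => by
      rw [H.linearGap_of_frontier m hy, mul_comm]
      refine mul_le_mul_of_nonneg_left ?_ (H.inner_nonneg hy.1)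
      have h1 : A ≤ c / 2 := min_le_right _ _
      linarith [H.inner_le y, hdist y])
  intro y hy hyr
  have hd1 : dist y p ≤ dist y x₀ + r := by
    rw [← hp, ← dist_eq_norm, dist_comm p x₀]; exact dist_triangle y x₀ p
  have hd2 : r ≤ dist y x₀ + dist y p := by
    rw [← hp, ← dist_eq_norm, dist_comm y p, add_comm]; exact dist_triangle _ _ _
  rw [← dist_eq_norm] at hyr
  have h1 := key y hy (by linarith) (by linarith)
  have h2 : Real.exp (-μ * (9 / 4)) ≤ Real.exp (-l * dist y p ^ 2) := by
    refine Real.exp_le_exp.2 ?_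
    rw [← hlr]
    have h3 : dist y p ^ 2 ≤ (3 / 2 * r) ^ 2 := pow_le_pow_left₀ dist_nonneg (by linarith) 2
    nlinarith
  have h3 : -l * (3 * r) ^ 2 = -μ * 9 := by rw [← hlr]; ring
  rw [h3] at h1
  have h4 : A * ⟪e, y - x₀⟫ * κ ≤ linearGap h e x₀ m y :=
    (mul_le_mul_of_nonneg_left (by linarith)
      (mul_nonneg hA0.le (H.inner_pos y hy).le)).trans h1
  rw [linearGap] at h4
  linarith

/-- Nontangential first order expansion at a boundary point. -/
theorem exists_expansion (H : IsHalfSpaceHarmonic Ω h e x₀) :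
    ∃ c : ℝ, ∀ a > 0, a ≤ 1 → ∀ δ > 0, ∃ r₀ > 0, ∀ p ∈ Ω, ‖p - x₀‖ < r₀ →
      ball p (a * ‖p - x₀‖) ⊆ Ω → |linearGap h e x₀ c p| ≤ δ * ‖p - x₀‖ := by
  set S : Set ℝ := {m | 0 ≤ m ∧ ∃ r > 0, ∀ y ∈ Ω, ‖y - x₀‖ < r → h y ≤ m * ⟪e, y - x₀⟫} with hS
  have hSne : S.Nonempty := by
    obtain ⟨D, hD0, hD⟩ := H.exists_le_mul_inner
    exact ⟨D, hD0, 1, one_pos, fun y hy _ => hD y hy⟩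
  have hSb : BddBelow S := ⟨0, fun m hm => hm.1⟩
  set c := sInf S with hc
  have hc0 : 0 ≤ c := le_csInf hSne fun m hm => hm.1
  have hupper : ∀ ε > 0, ∃ r > 0, ∀ y ∈ Ω, ‖y - x₀‖ < r → h y ≤ (c + ε) * ⟪e, y - x₀⟫ := by
    intro ε hε
    obtain ⟨m, ⟨-, r, hr, hm⟩, hmc⟩ := exists_lt_of_csInf_lt hSne (lt_add_of_pos_right c hε)
    exact ⟨r, hr, fun y hy hyr => (hm y hy hyr).trans
      (mul_le_mul_of_nonneg_right hmc.le (H.inner_pos y hy).le)⟩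
  have hlower : ∀ a > 0, a ≤ 1 → ∀ δ > 0, ∃ r₀ > 0, ∀ p ∈ Ω, ‖p - x₀‖ < r₀ →
      ball p (a * ‖p - x₀‖) ⊆ Ω → (c - δ) * ⟪e, p - x₀⟫ ≤ h p := by
    intro a ha ha1 δ hδ
    rcases hc0.eq_or_lt with h0 | hcpos
    · refine ⟨1, one_pos, fun p hp _ _ => ?_⟩
      nlinarith [H.nonneg hp, H.inner_pos p hp]
    obtain ⟨ε, hε, himp⟩ := H.exists_improvement ha ha1 hδ hcpos
    obtain ⟨r, hr, hup⟩ := hupper (min 1 (ε / 2)) (by positivity)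
    refine ⟨min (r / 5) (c / 10), by positivity, fun p hp hpr hpΩ => ?_⟩
    have hpr1 : ‖p - x₀‖ < r / 5 := hpr.trans_le (min_le_left _ _)
    have hpr2 : ‖p - x₀‖ < c / 10 := hpr.trans_le (min_le_right _ _)
    have hε1 : min 1 (ε / 2) ≤ 1 := min_le_left _ _
    have hε2 : min 1 (ε / 2) ≤ ε / 2 := min_le_right _ _
    have hε0 : 0 < min 1 (ε / 2) := by positivity
    have hpp : 0 < ‖p - x₀‖ := (H.inner_pos p hp).trans_le (H.inner_le p)
    by_contra! hlt
    have hbetter := himp (c + min 1 (ε / 2)) ‖p - x₀‖ p (by linarith) (by linarith) hpp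
      (by linarith) rfl hpΩ (H.le_inner_of_ball_subset hp hpΩ)
      (fun y hy hyr => hup y hy (by linarith))
      (by nlinarith [H.inner_pos p hp])
    have hmem : max 0 (c + min 1 (ε / 2) - ε) ∈ S :=
      ⟨le_max_left _ _, ‖p - x₀‖ / 2, by positivity, fun y hy hyr => (hbetter y hy hyr).trans
        (mul_le_mul_of_nonneg_right (le_max_right _ _) (H.inner_pos y hy).le)⟩
    have h1 : c ≤ max 0 (c + min 1 (ε / 2) - ε) := csInf_le hSb hmem
    have h2 : max 0 (c + min 1 (ε / 2) - ε) < c := max_lt hcpos (by linarith)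
    linarith
  refine ⟨c, fun a ha ha1 δ hδ => ?_⟩
  obtain ⟨r₁, hr₁, h₁⟩ := hlower a ha ha1 δ hδ
  obtain ⟨r₂, hr₂, h₂⟩ := hupper δ hδ
  refine ⟨min r₁ r₂, by positivity, fun p hp hpr hpΩ => ?_⟩
  have h3 := h₁ p hp (hpr.trans_le (min_le_left _ _)) hpΩ
  have h4 := h₂ p hp (hpr.trans_le (min_le_right _ _))
  have h5 := mul_le_mul_of_nonneg_left (H.inner_le p) hδ.le
  rw [linearGap, abs_le]
  constructor <;> linarith

/-- Nontangential convergence of the derivative at a boundary point. -/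
theorem exists_fderiv_limit (H : IsHalfSpaceHarmonic Ω h e x₀) :
    ∃ c : ℝ, ∀ a > 0, a ≤ 1 → ∀ δ > 0, ∃ r₀ > 0, ∀ p ∈ Ω, ‖p - x₀‖ < r₀ →
      ball p (a * ‖p - x₀‖) ⊆ Ω → ‖fderiv ℝ h p - c • innerSL ℝ e‖ ≤ δ := by
  obtain ⟨c, hc⟩ := H.exists_expansion
  refine ⟨c, fun a ha ha1 δ hδ => ?_⟩
  have hn : (0 : ℝ) < finrank ℝ E := by exact_mod_cast finrank_pos
  obtain ⟨r₀, hr₀, hexp⟩ := hc (a / 3) (by positivity) (by linarith)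
    (δ * a / (3 * finrank ℝ E)) (by positivity)
  refine ⟨r₀ / 2, by positivity, fun p hp hpr hpΩ => ?_⟩
  set r := ‖p - x₀‖ with hr
  have hr0 : 0 < r := (H.inner_pos p hp).trans_le (H.inner_le p)
  have har : 0 < a * r := by positivity
  have har1 : a * r ≤ r := by nlinarith
  have hball : ∀ z ∈ closedBall p (a * r / 2), ball z (a * r / 2) ⊆ Ω := fun z hz =>
    (ball_subset_ball' (by linarith [mem_closedBall.1 hz])).trans hpΩ
  have hmem : ∀ z ∈ closedBall p (a * r / 2), z ∈ Ω := fun z hz =>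
    hball z hz (mem_ball_self (by positivity))
  have hgrad := norm_fderiv_le_of_harmonic (v := linearGap h e x₀ c) (p := p) (d := a * r / 2)
    (N := δ * a / (3 * finrank ℝ E) * (3 / 2 * r)) (by positivity)
    (fun z hz => H.contDiffAt_linearGap c (hmem z hz))
    (fun z hz => H.laplacian_linearGap c (hmem z hz))
    (fun z hz => by
      have h1 : ‖z - x₀‖ ≤ 3 / 2 * r := by
        have h2 := mem_closedBall.1 hz
        have h3 := norm_sub_le_norm_sub_add_norm_sub z p x₀
        rw [← dist_eq_norm z p] at h3
        linarith
      refine (hexp z (hmem z hz) (by linarith)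
        ((ball_subset_ball ?_).trans (hball z hz))).trans (by gcongr)
      nlinarith)
  have h1 : HasFDerivAt (linearGap h e x₀ c) (c • innerSL ℝ e - fderiv ℝ h p) p :=
    ((hasFDerivAt_inner_sub e x₀ p).const_smul c).sub
      ((H.contDiffAt p hp).differentiableAt (by simp)).hasFDerivAt
  rw [h1.fderiv, norm_sub_rev] at hgrad
  refine hgrad.trans_eq ?_
  field_simp

end IsHalfSpaceHarmonic
end Support
end Laplacian

theorem ball_infDist_frontier_subset {E : Type*} [NormedAddCommGroup E] [NormedSpace ℝ E]
    {Ω : Set E} {y : E} (hy : y ∈ Ω) : ball y (infDist y (frontier Ω)) ⊆ Ω := by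
  intro z hz
  by_contra hzΩ
  have hyb : y ∈ ball y (infDist y (frontier Ω)) :=
    mem_ball_self (dist_nonneg.trans_lt (mem_ball.1 hz))
  have hfr : ∀ w ∈ ball y (infDist y (frontier Ω)), w ∉ frontier Ω := fun w hw hwf =>
    (mem_ball'.1 hw).not_ge (infDist_le_dist_of_mem hwf)
  obtain ⟨w, -, hw1, hw2⟩ := (convex_ball y (infDist y (frontier Ω))).isPreconnected
    (interior Ω) (closure Ω)ᶜ isOpen_interior isClosed_closure.isOpen_compl
    (fun w hw => by
      by_contra hn
      simp only [mem_union, mem_compl_iff, not_or, not_not] at hn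
      exact hfr w hw ⟨hn.2, hn.1⟩)
    ⟨y, hyb, by_contra fun hn => hfr y hyb ⟨subset_closure hy, hn⟩⟩
    ⟨z, hz, fun hn => hfr z hz ⟨hn, fun hzi => hzΩ (interior_subset hzi)⟩⟩
  exact hw2 (subset_closure (interior_subset hw1))

/-- A boundary point of an open convex set lies on a supporting hyperplane. -/
theorem exists_unit_normal {E : Type*} [NormedAddCommGroup E] [InnerProductSpace ℝ E]
    [CompleteSpace E] {Ω : Set E} (hΩo : IsOpen Ω) (hΩc : Convex ℝ Ω) {x₀ : E}
    (hx : x₀ ∈ frontier Ω) : ∃ e : E, ‖e‖ = 1 ∧ ∀ y ∈ Ω, 0 < ⟪e, y - x₀⟫ := by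
  have hxΩ : x₀ ∉ Ω := by simpa [hΩo.interior_eq] using hx.2
  obtain ⟨f, hf⟩ := geometric_hahn_banach_point_open hΩc hΩo hxΩ
  obtain ⟨y₀, hy₀⟩ : Ω.Nonempty := closure_nonempty_iff.1 ⟨x₀, hx.1⟩
  set v := (InnerProductSpace.toDual ℝ E).symm f with hv
  have hvf : ∀ y, ⟪v, y⟫ = f y := fun y => InnerProductSpace.toDual_symm_apply
  have hpos : ∀ y ∈ Ω, 0 < ⟪v, y - x₀⟫ := fun y hy => by
    rw [hvf, map_sub]
    linarith [hf y hy]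
  have hv0 : v ≠ 0 := fun h0 => by simpa [h0] using hpos y₀ hy₀
  refine ⟨(‖v‖⁻¹ : ℝ) • v, by simpa using norm_smul_inv_norm (𝕜 := ℝ) hv0, fun y hy => ?_⟩
  rw [inner_smul_left, RCLike.conj_to_real]
  exact mul_pos (inv_pos.2 (norm_pos_iff.2 hv0)) (hpos y hy)

theorem lapl_eq_laplacian (u : Euc n → ℝ) : lapl u = Laplacian.laplacian u := by
  ext x
  rw [InnerProductSpace.laplacian_eq_iteratedFDeriv_orthonormalBasis u
    (EuclideanSpace.basisFun (Fin n) ℝ), lapl]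
  refine Finset.sum_congr rfl fun i _ => ?_
  congr 1
  ext j : 1
  fin_cases j <;> simp

theorem IsTorsionFunction.isHalfSpaceHarmonic {Ω : Set (Euc n)} {u : Euc n → ℝ} {e x₀ : Euc n}
    (hu : IsTorsionFunction Ω u) (hΩo : IsOpen Ω) (hΩb : IsBounded Ω) (he : ‖e‖ = 1)
    (hpos : ∀ y ∈ Ω, 0 < ⟪e, y - x₀⟫) :
    IsHalfSpaceHarmonic Ω (u + fun y => ⟪e, y - x₀⟫ ^ 2) e x₀ := by
  have hq : (fun y => ⟪e, y - x₀⟫ ^ 2) = fun y : Euc n =>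
      0 * ‖y - x₀‖ ^ 2 + 1 * ⟪e, y - x₀⟫ ^ 2 + 0 * ⟪e, y - x₀⟫ + 0 := by
    ext y; ring
  have hus : ∀ y ∈ Ω, ContDiffAt ℝ 2 u y := fun y hy =>
    (hu.smooth.contDiffAt (hΩo.mem_nhds hy)).of_le (by norm_cast)
  have hqs : ContDiff ℝ 2 fun y : Euc n => ⟪e, y - x₀⟫ ^ 2 := by
    rw [hq]; exact contDiff_quadratic _ _ _ _ _ _
  refine ⟨hΩo, hΩb, he, hpos, hu.continuousOn.add hqs.continuous.continuousOn,
    fun y hy => (hus y hy).add hqs.contDiffAt, fun y hy => ?_, fun y hy => ?_⟩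
  · rw [(hus y hy).laplacian_add hqs.contDiffAt, ← lapl_eq_laplacian, hu.lapl_eq y hy, hq,
      laplacian_quadratic, he]
    norm_num
  · simp [hu.boundary_zero y hy]

/-- The gradient of the torsion function of an open bounded convex set has a finite nontangential
limit at every boundary point. -/
theorem gradient_torsion_hasNTLimit {Ω : Set (Euc n)} (hΩo : IsOpen Ω) (hΩb : IsBounded Ω)
    (hΩc : Convex ℝ Ω) {u : Euc n → ℝ} (hu : IsTorsionFunction Ω u) {x : Euc n}
    (hx : x ∈ frontier Ω) : ∃ L : Euc n, HasNTLimitAt Ω (gradient u) x L := by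
  obtain ⟨e, he, hpos⟩ := exists_unit_normal hΩo hΩc hx
  have : Nontrivial (Euc n) := ⟨e, 0, fun h0 => by simp [h0] at he⟩
  have H := hu.isHalfSpaceHarmonic hΩo hΩb he hpos
  obtain ⟨c, hc⟩ := H.exists_fderiv_limit
  refine ⟨c • e, fun α hα => Metric.tendsto_nhdsWithin_nhds.2 fun ε hε => ?_⟩
  obtain ⟨r, hr, hlim⟩ := hc (1 / (1 + α)) (by positivity)
    ((div_le_one (by positivity)).2 (by linarith)) (ε / 2) (by positivity)
  refine ⟨min r (ε / 4), by positivity, ?_⟩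
  rintro p ⟨hp, hpα⟩ hpr
  rw [dist_eq_norm] at hpα hpr ⊢
  have hpr1 : ‖p - x‖ < r := hpr.trans_le (min_le_left _ _)
  have hpr2 : ‖p - x‖ < ε / 4 := hpr.trans_le (min_le_right _ _)
  have hball : ball p (1 / (1 + α) * ‖p - x‖) ⊆ Ω := by
    refine (ball_subset_ball ?_).trans (ball_infDist_frontier_subset hp)
    rw [one_div_mul_eq_div, div_le_iff₀ (by positivity)]
    linarith
  have h1 := hlim p hp hpr1 hball
  have hud : HasFDerivAt u (fderiv ℝ u p) p :=
    ((hu.smooth.contDiffAt (hΩo.mem_nhds hp)).differentiableAt (by simp)).hasFDerivAt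
  have hld : HasFDerivAt (fun y : Euc n => ⟪e, y - x⟫) (innerSL ℝ e) p :=
    hasFDerivAt_inner_sub e x p
  have hsq : HasFDerivAt (fun y : Euc n => ⟪e, y - x⟫ ^ 2) ((2 * ⟪e, p - x⟫) • innerSL ℝ e) p := by
    simpa using hld.pow 2
  rw [(hud.add hsq).fderiv] at h1
  have hinn : 0 < ⟪e, p - x⟫ := hpos p hp
  have h2 : ‖(2 * ⟪e, p - x⟫) • innerSL ℝ e‖ ≤ 2 * ‖p - x‖ := by
    rw [norm_smul, innerSL_apply_norm, he, mul_one, Real.norm_of_nonneg (by positivity)]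
    linarith [H.inner_le p]
  have h3 : gradient u p - c • e =
      (InnerProductSpace.toDual ℝ (Euc n)).symm (fderiv ℝ u p - c • innerSL ℝ e) := by
    rw [map_sub, gradient]
    congr 1
    rw [LinearIsometryEquiv.eq_symm_apply, map_smul]
    rfl
  rw [h3, LinearIsometryEquiv.norm_map]
  calc ‖fderiv ℝ u p - c • innerSL ℝ e‖
      = ‖(fderiv ℝ u p + (2 * ⟪e, p - x⟫) • innerSL ℝ e - c • innerSL ℝ e) -
          (2 * ⟪e, p - x⟫) • innerSL ℝ e‖ := by congr 1; abel
    _ ≤ ε / 2 + 2 * ‖p - x‖ := (norm_sub_le _ _).trans (add_le_add h1 h2)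
    _ < ε := by linarith

/-- The gradient of the torsion function of an open bounded convex set `Ω` has a finite
nontangential limit at `H^{n-1}`-a.e. point of `∂Ω`. -/
theorem gradient_torsion_hasNTLimit_ae (Ω : Set (Euc n))
    (hΩo : IsOpen Ω) (hΩb : IsBounded Ω) (hΩc : Convex ℝ Ω)
    (u : Euc n → ℝ) (hu : IsTorsionFunction Ω u) :
    ∀ᵐ x ∂(μH[(n : ℝ) - 1]).restrict (frontier Ω),
      ∃ L : Euc n, HasNTLimitAt Ω (gradient u) x L := by
  filter_upwards [ae_restrict_mem isClosed_frontier.measurableSet] with x hx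
  exact gradient_torsion_hasNTLimit hΩo hΩb hΩc hu hx

end
end

section
/- Let Ω and Ω_i (i ∈ ℕ) be open bounded convex subsets of ℝ^n such that cl(Ω_i) → cl(Ω) in the Hausdorff metric, and let ν, ν_i denote the Gauss maps of cl(Ω) and cl(Ω_i). Let x ∈ ∂Ω be a point where ∂Ω is differentiable (so ν(x) is defined), and let x_i ∈ ∂Ω_i be points with x_i → x such that ∂Ω_i is differentiable at x_i for every i. Then ν_i(x_i) → ν(x) as i → ∞. -/
open MeasureTheory Metric Set Filter Bornology
open scoped Topology Pointwise RealInnerProductSpace ENNReal NNReal BigOperators Classical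

noncomputable section

variable {n : ℕ}

theorem gaussMap_spec {K : Set (Euc n)} {x : Euc n} (h : ∃! X, IsOuterNormalAt K x X) :
    IsOuterNormalAt K x (gaussMap K x) := by
  rw [gaussMap, dif_pos h]
  exact h.choose_spec.1

/-- A limit of outer unit normals is an outer unit normal, provided that every point of the limit
set is a limit of points of the approximating sets. -/
theorem IsOuterNormalAt.of_tendsto {K : Set (Euc n)} {Ks : ℕ → Set (Euc n)} {x X : Euc n}
    {xs Xs : ℕ → Euc n} (h : ∀ i, IsOuterNormalAt (Ks i) (xs i) (Xs i))
    (hx : Tendsto xs atTop (𝓝 x)) (hX : Tendsto Xs atTop (𝓝 X))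
    (hK : ∀ y ∈ K, ∃ ys : ℕ → Euc n, (∀ i, ys i ∈ Ks i) ∧ Tendsto ys atTop (𝓝 y)) :
    IsOuterNormalAt K x X := by
  refine ⟨tendsto_nhds_unique hX.norm (by simp [fun i => (h i).1]), fun y hy => ?_⟩
  obtain ⟨ys, hys, hlim⟩ := hK y hy
  exact le_of_tendsto_of_tendsto' (hlim.inner hX) (hx.inner hX) fun i => (h i).2 _ (hys i)

/-- Every point of a Hausdorff limit of bounded nonempty sets is a limit of points of these
sets. -/
theorem exists_tendsto_of_tendsto_hausdorffDist {α : Type*} [PseudoMetricSpace α] {K : Set α}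
    {Ks : ℕ → Set α} (hK : IsBounded K) (hKs : ∀ i, IsBounded (Ks i) ∧ (Ks i).Nonempty)
    (hconv : Tendsto (fun i => hausdorffDist (Ks i) K) atTop (𝓝 0)) {y : α} (hy : y ∈ K) :
    ∃ ys : ℕ → α, (∀ i, ys i ∈ Ks i) ∧ Tendsto ys atTop (𝓝 y) := by
  have hε : Tendsto (fun i : ℕ => 1 / ((i : ℝ) + 1)) atTop (𝓝 0) :=
    tendsto_one_div_add_atTop_nhds_zero_nat
  have key : ∀ i, ∃ z ∈ Ks i, dist z y < hausdorffDist (Ks i) K + 1 / ((i : ℝ) + 1) := fun i =>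
    exists_dist_lt_of_hausdorffDist_lt' hy (lt_add_of_pos_right _ Nat.one_div_pos_of_nat)
      (hausdorffEDist_ne_top_of_nonempty_of_bounded (hKs i).2 ⟨y, hy⟩ (hKs i).1 hK)
  choose ys hys hlt using key
  refine ⟨ys, hys, tendsto_iff_dist_tendsto_zero.2 ?_⟩
  exact squeeze_zero (fun _ => dist_nonneg) (fun i => (hlt i).le) (by simpa using hconv.add hε)

/-- Convergence of Gauss maps: if `cl(Ω_i) → cl(Ω)` in the Hausdorff metric,
`x_i ∈ ∂Ω_i` are differentiability points of `∂Ω_i` converging to a differentiability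
point `x ∈ ∂Ω`, then `ν_i(x_i) → ν(x)`. -/
theorem tendsto_gaussMap (Ω : Set (Euc n)) (Ωs : ℕ → Set (Euc n))
    (hΩo : IsOpen Ω) (hΩb : IsBounded Ω) (hΩc : Convex ℝ Ω) (hΩne : Ω.Nonempty)
    (hΩs : ∀ i, IsOpen (Ωs i) ∧ IsBounded (Ωs i) ∧ Convex ℝ (Ωs i) ∧ (Ωs i).Nonempty)
    (hconv : Tendsto (fun i => hausdorffDist (closure (Ωs i)) (closure Ω)) atTop (𝓝 0))
    (x : Euc n) (hx : x ∈ frontier Ω)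
    (hdx : ∃! X, IsOuterNormalAt (closure Ω) x X)
    (xs : ℕ → Euc n) (hxs : ∀ i, xs i ∈ frontier (Ωs i))
    (hdxs : ∀ i, ∃! X, IsOuterNormalAt (closure (Ωs i)) (xs i) X)
    (hxc : Tendsto xs atTop (𝓝 x)) :
    Tendsto (fun i => gaussMap (closure (Ωs i)) (xs i)) atTop
      (𝓝 (gaussMap (closure Ω) x)) := by
  refine tendsto_of_subseq_tendsto fun ns hns => ?_
  have hnormal := fun i => gaussMap_spec (hdxs i)
  obtain ⟨X, -, ms, hms, hlim⟩ :=
    (isCompact_sphere (0 : Euc n) 1).tendsto_subseq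
      (x := fun i => gaussMap (closure (Ωs (ns i))) (xs (ns i)))
      fun i => mem_sphere_zero_iff_norm.2 (hnormal _).1
  have hsub : Tendsto (fun i => ns (ms i)) atTop atTop := hns.comp hms.tendsto_atTop
  have hX : IsOuterNormalAt (closure Ω) x X :=
    IsOuterNormalAt.of_tendsto (fun i => hnormal (ns (ms i))) (hxc.comp hsub) hlim fun _ hy =>
      exists_tendsto_of_tendsto_hausdorffDist hΩb.closure
        (fun i => ⟨(hΩs _).2.1.closure, (hΩs _).2.2.2.closure⟩) (hconv.comp hsub) hy
  exact ⟨ms, hdx.unique hX (gaussMap_spec hdx) ▸ hlim⟩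

end
end

section
/- Let Ω ⊂ ℝ^n be an open bounded convex set containing the origin, with support function h of cl(Ω), let f ∈ C(S^{n−1}), and let r, R > 0 be such that B_r ⊂ Ω ⊂ B_R (balls centered at the origin). Let h_t denote the support function of B[h + tf] (defined for |t| sufficiently small), and let M = max_{S^{n−1}} |f|. Then sup_{0 ≤ t ≤ r/(2M)} (1/t) |h_t(X) − h(X)| ≤ RM/r for every X ∈ S^{n−1}. -/
open MeasureTheory Metric Set Filter Bornology
open scoped Topology Pointwise RealInnerProductSpace ENNReal NNReal BigOperators Classical

noncomputable section

variable {n : ℕ}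

theorem mul_norm_mem_upperBounds_inner_image {K : Set (Euc n)} {R : ℝ} (hK : K ⊆ closedBall 0 R)
    (X : Euc n) :
    R * ‖X‖ ∈ upperBounds ((fun y => ⟪y, X⟫) '' K) := by
  rintro _ ⟨y, hy, rfl⟩
  exact (real_inner_le_norm y X).trans
    (mul_le_mul_of_nonneg_right (mem_closedBall_zero_iff.1 (hK hy)) (norm_nonneg X))

theorem inner_le_suppFn {K : Set (Euc n)} {R : ℝ} (hK : K ⊆ closedBall 0 R) {x : Euc n}
    (hx : x ∈ K) (X : Euc n) : ⟪x, X⟫ ≤ suppFn K X :=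
  le_csSup ⟨_, mul_norm_mem_upperBounds_inner_image hK X⟩ ⟨x, hx, rfl⟩

theorem suppFn_le {K : Set (Euc n)} (hK : K.Nonempty) {X : Euc n} {c : ℝ}
    (h : ∀ x ∈ K, ⟪x, X⟫ ≤ c) : suppFn K X ≤ c := by
  refine csSup_le (hK.image _) ?_
  rintro _ ⟨x, hx, rfl⟩
  exact h x hx

theorem inner_le_suppFn_alexandrovBody {g : Euc n → ℝ} {x X : Euc n}
    (hX : X ∈ sphere (0 : Euc n) 1) (hx : x ∈ alexandrovBody g) :
    ⟪x, X⟫ ≤ suppFn (alexandrovBody g) X := by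
  refine le_csSup ⟨g X, ?_⟩ ⟨x, hx, rfl⟩
  rintro _ ⟨y, hy, rfl⟩
  exact hy X hX

/-- A set squeezed between the balls of radii `r` and `R` has its support function between `r`
and `R` on the unit sphere. -/
theorem suppFn_mem_Icc {K : Set (Euc n)} {r R : ℝ} (hr : 0 ≤ r) (hrK : closedBall 0 r ⊆ K)
    (hKR : K ⊆ closedBall 0 R) {X : Euc n} (hX : X ∈ sphere (0 : Euc n) 1) :
    suppFn K X ∈ Icc r R := by
  have hX1 : ‖X‖ = 1 := by simpa using hX
  constructor
  · have hmem : r • X ∈ K :=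
      hrK (by simp [norm_smul, hX1, abs_of_nonneg hr])
    simpa [real_inner_smul_left, hX1] using inner_le_suppFn hKR hmem X
  · refine suppFn_le ⟨0, hrK (by simpa using hr)⟩ fun x hx => ?_
    simpa [hX1] using mul_norm_mem_upperBounds_inner_image hKR X ⟨x, hx, rfl⟩

/-- If `B_r ⊆ Ω ⊆ B_R`, `M = max_{S^{n-1}} |f|` and `h_t` is the support function of
`B[h + tf]`, then `(1/t)|h_t(X) - h(X)| ≤ RM/r` for every `X ∈ S^{n-1}` and every
`0 < t ≤ r/(2M)`. -/
theorem abs_suppFn_alexandrov_sub_le (Ω : Set (Euc n))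
    (hΩo : IsOpen Ω) (hΩb : IsBounded Ω) (hΩc : Convex ℝ Ω)
    (h0 : (0 : Euc n) ∈ Ω)
    (f : Euc n → ℝ) (hf : ContinuousOn f (sphere (0 : Euc n) 1))
    (r R : ℝ) (hr : 0 < r) (hR : 0 < R)
    (hrΩ : ball (0 : Euc n) r ⊆ Ω) (hΩR : Ω ⊆ ball (0 : Euc n) R)
    (M : ℝ) (hM : IsGreatest ((fun X => |f X|) '' sphere (0 : Euc n) 1) M) :
    ∀ t : ℝ, 0 < t → t ≤ r / (2 * M) →
      ∀ X ∈ sphere (0 : Euc n) 1,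
        (1 / t) *
            |suppFn (alexandrovBody (fun Y => suppFn (closure Ω) Y + t * f Y)) X -
              suppFn (closure Ω) X| ≤ R * M / r := by
  intro t ht htM X hX
  have hM0 : 0 < M := by
    by_contra! h
    have : r / (2 * M) ≤ 0 := div_nonpos_of_nonneg_of_nonpos hr.le (by linarith)
    linarith
  have hfM : ∀ Y ∈ sphere (0 : Euc n) 1, |f Y| ≤ M := fun Y hY => hM.2 ⟨Y, hY, rfl⟩
  have htM' : t * M / r ≤ 1 / 2 := by
    rw [le_div_iff₀ (by positivity)] at htM
    rw [div_le_iff₀ hr]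
    linarith
  have hKR : closure Ω ⊆ closedBall 0 R :=
    closure_minimal (hΩR.trans ball_subset_closedBall) isClosed_closedBall
  have hrK : closedBall 0 r ⊆ closure Ω := by
    rw [← closure_ball (0 : Euc n) hr.ne']
    exact closure_mono hrΩ
  have hbd : ∀ Y ∈ sphere (0 : Euc n) 1, suppFn (closure Ω) Y ∈ Icc r R :=
    fun Y hY => suppFn_mem_Icc hr.le hrK hKR hY
  set h := suppFn (closure Ω)
  set B := alexandrovBody (fun Y => h Y + t * f Y)
  set c := 1 - t * M / r with hc
  have hc0 : 0 < c := by linarith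
  have hshrink : ∀ x ∈ closure Ω, c • x ∈ B := by
    intro x hx Y hY
    have h1 : c * ⟪x, Y⟫ ≤ c * h Y :=
      mul_le_mul_of_nonneg_left (inner_le_suppFn hKR hx Y) hc0.le
    have h2 : t * M ≤ t * M / r * h Y := by
      rw [div_mul_eq_mul_div, le_div_iff₀ hr]
      exact mul_le_mul_of_nonneg_left (hbd Y hY).1 (by positivity)
    have h3 : t * (-M) ≤ t * f Y :=
      mul_le_mul_of_nonneg_left (abs_le.1 (hfM Y hY)).1 ht.le
    rw [real_inner_smul_left]
    have h4 : c * h Y = h Y - t * M / r * h Y := by rw [hc]; ring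
    show c * ⟪x, Y⟫ ≤ h Y + t * f Y
    linarith
  have hlow : c * h X ≤ suppFn B X := by
    rw [mul_comm, ← le_div_iff₀ hc0]
    refine suppFn_le ⟨0, subset_closure h0⟩ fun x hx => ?_
    rw [le_div_iff₀ hc0, mul_comm, ← real_inner_smul_left]
    exact inner_le_suppFn_alexandrovBody hX (hshrink x hx)
  have hup : suppFn B X ≤ h X + t * f X :=
    suppFn_le ⟨_, hshrink 0 (subset_closure h0)⟩ fun x hx => hx X hX
  have hXr := (hbd X hX).1
  have hXR := (hbd X hX).2
  have e : t * (R * M / r) = t * M / r * R := by ring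
  rw [one_div, inv_mul_le_iff₀ ht, e, abs_le]
  have hq : 0 ≤ t * M / r := by positivity
  constructor
  · have h1 : t * M / r * h X ≤ t * M / r * R := mul_le_mul_of_nonneg_left hXR hq
    have h2 : c * h X = h X - t * M / r * h X := by rw [hc]; ring
    linarith
  · have h1 : t * f X ≤ t * M :=
      mul_le_mul_of_nonneg_left (abs_le.1 (hfM X hX)).2 ht.le
    have h2 : t * M / r * r ≤ t * M / r * R :=
      mul_le_mul_of_nonneg_left (hXr.trans hXR) hq
    rw [div_mul_cancel₀ _ hr.ne'] at h2
    linarith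

end
end
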